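/- arXiv:2201.02701 — 2 statements merged into one kernel-verified Lean document; each statement's English description precedes it below -/
import Mathlib

section
/- Let U be a subunital of order q of the generalized hermitian unital H(C|R) with q > 2, let p ∈ U, and let x₀, x ∈ U \ {p} be distinct points such that p, x₀ and x lie on a common block of H(C|R). Then there exists a translation τ of H(C|R) with center p such that τ(x₀) = x and τ(U) = U. -/
noncomputable section

/-- A line of the projective plane `PG(2,C)`: the zero set of a nonzero linear form. -/
def IsLine (C : Type*) [Field C] (ℓ : Set (Projectivization C (Fin 3 → C))) : Prop :=
  ∃ f : (Fin 3 → C) →ₗ[C] C, f ≠ 0 ∧ ℓ = {P : Projectivization C (Fin 3 → C) | f P.rep = 0}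

/-- The point set of the generalized hermitian unital `H(C|R)`:
points `[X,Y,Z]` with `σ(X)·Y + σ(Z)·Z ∈ εR`. -/
def hermSet {C : Type*} [Field C] (R : Subfield C) (σ : C →+* C) (ε : C) :
    Set (Projectivization C (Fin 3 → C)) :=
  {P | ∃ v : Fin 3 → C, ∃ hv : v ≠ 0, P = Projectivization.mk C v hv ∧
        ∃ r ∈ R, σ (v 0) * v 1 + σ (v 2) * v 2 = ε * r}

/-- A block of `H(C|R)`: the trace of a line meeting the point set in at least two points. -/
def IsHermBlock {C : Type*} [Field C] (R : Subfield C) (σ : C →+* C) (ε : C)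
    (B : Set (Projectivization C (Fin 3 → C))) : Prop :=
  ∃ ℓ, IsLine C ℓ ∧ (hermSet R σ ε ∩ ℓ).Nontrivial ∧ B = hermSet R σ ε ∩ ℓ

/-- A subunital of order `q` of `H(C|R)`: a set `U` of `q³ + 1` points of the unital
such that every block containing at least two points of `U` contains exactly
`q + 1` points of `U`. -/
def IsSubunital {C : Type*} [Field C] (R : Subfield C) (σ : C →+* C) (ε : C)
    (q : ℕ) (U : Set (Projectivization C (Fin 3 → C))) : Prop :=
  U ⊆ hermSet R σ ε ∧ U.ncard = q ^ 3 + 1 ∧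
    ∀ B, IsHermBlock R σ ε B → (B ∩ U).Nontrivial → (B ∩ U).ncard = q + 1

/-- An automorphism of the incidence structure `(H, Bl)`: a bijection of `H`
mapping blocks onto blocks. -/
def IsUnitalAuto {P : Type*} (H : Set P) (Bl : Set P → Prop) (φ : P → P) : Prop :=
  Set.BijOn φ H H ∧ (∀ B, Bl B → Bl (φ '' B)) ∧ (∀ B, Bl B → ∃ B', Bl B' ∧ φ '' B' = B)

/-- A translation with center `z`: an automorphism fixing `z` and mapping each
block through `z` onto itself. -/
def IsTranslation {P : Type*} (H : Set P) (Bl : Set P → Prop) (z : P) (φ : P → P) : Prop :=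
  IsUnitalAuto H Bl φ ∧ φ z = z ∧ ∀ B, Bl B → z ∈ B → φ '' B = B

/-- Let `W` be a set of `q ^ 3` pairs all of whose fibres over the first coordinate have size `q`,
and suppose that points in different fibres are joined by transversals of size `q + 1`, where
transversals joining the same two fibres with different slopes share no third fibre.
Then the fibres are parallel: `a - b + b'` stays in the fibre of `a`. -/
theorem fiber_add_sub_mem {F G : Type*} [DecidableEq F] [DecidableEq G] [AddCommGroup G]
    (W : Finset (F × G)) (q : ℕ) (hq : 2 ≤ q) (hcard : W.card = q ^ 3)
    (hfib : ∀ w ∈ W, (W.filter (fun w' => w'.1 = w.1)).card = q)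
    (L : F × G → F × G → Finset (F × G))
    (hL : ∀ w₁ ∈ W, ∀ w₂ ∈ W, w₁.1 ≠ w₂.1 → w₁ ∈ L w₁ w₂ ∧ w₂ ∈ L w₁ w₂ ∧
      L w₁ w₂ ⊆ W ∧ (L w₁ w₂).card = q + 1 ∧ Set.InjOn Prod.fst (L w₁ w₂ : Set (F × G)))
    (hdisj : ∀ z₁ z₂ : F, z₁ ≠ z₂ → ∀ r₁ r₂ s₁ s₂ : G,
      (z₁, r₁) ∈ W → (z₂, r₂) ∈ W → (z₁, s₁) ∈ W → (z₂, s₂) ∈ W →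
      ∀ z r s, z ≠ z₁ → z ≠ z₂ → (z, r) ∈ L (z₁, r₁) (z₂, r₂) →
      (z, s) ∈ L (z₁, s₁) (z₂, s₂) → r₁ - r₂ = s₁ - s₂)
    {z₁ z₂ : F} (hz : z₁ ≠ z₂) {a b b' : G} (ha : (z₁, a) ∈ W) (hb : (z₂, b) ∈ W)
    (hb' : (z₂, b') ∈ W) : (z₁, a - b + b') ∈ W := by
  set Z := W.image Prod.fst with hZ
  have hZcard : Z.card = q ^ 2 := by
    have h := Finset.card_eq_sum_card_image Prod.fst W
    rw [Finset.sum_const_nat (m := q), hcard, ← hZ] at h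
    · have : q ^ 2 * q = Z.card * q := by rw [← h]; ring
      exact (Nat.eq_of_mul_eq_mul_right (by omega) this).symm
    · intro z hz
      obtain ⟨w, hw, rfl⟩ := Finset.mem_image.1 hz
      exact hfib w hw
  let A : F → Finset G := fun z => (W.filter (fun w => w.1 = z)).image Prod.snd
  have memA : ∀ z r, r ∈ A z ↔ (z, r) ∈ W := by
    intro z r
    simp [A]
  have cardA : ∀ z r, (z, r) ∈ W → (A z).card = q := by
    intro z r h
    rw [Finset.card_image_of_injOn, hfib _ h]
    rintro ⟨x, y⟩ hx ⟨x', y'⟩ hx' h'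
    simp_all
  let D : Finset G := (A z₁ ×ˢ A z₂).image (fun r => r.1 - r.2)
  have hD : ∀ δ ∈ D, ∃ r : G × G, (z₁, r.1) ∈ W ∧ (z₂, r.2) ∈ W ∧ r.1 - r.2 = δ := by
    intro δ hδ
    obtain ⟨r, hr, rfl⟩ := Finset.mem_image.1 hδ
    rw [Finset.mem_product, memA, memA] at hr
    exact ⟨r, hr.1, hr.2, rfl⟩
  choose! c hc₁ hc₂ hcd using hD
  let T : G → Finset F := fun δ =>
    (((L (z₁, (c δ).1) (z₂, (c δ).2)).image Prod.fst).erase z₁).erase z₂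
  have cardT : ∀ δ ∈ D, (T δ).card = q - 1 := by
    intro δ hδ
    obtain ⟨h₁, h₂, -, h₄, h₅⟩ := hL _ (hc₁ δ hδ) _ (hc₂ δ hδ) hz
    have m₁ : z₁ ∈ (L (z₁, (c δ).1) (z₂, (c δ).2)).image Prod.fst :=
      Finset.mem_image.2 ⟨_, h₁, rfl⟩
    have m₂ : z₂ ∈ ((L (z₁, (c δ).1) (z₂, (c δ).2)).image Prod.fst).erase z₁ :=
      Finset.mem_erase.2 ⟨hz.symm, Finset.mem_image.2 ⟨_, h₂, rfl⟩⟩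
    rw [Finset.card_erase_of_mem m₂, Finset.card_erase_of_mem m₁, Finset.card_image_of_injOn h₅,
      h₄]
    omega
  have disjT : (D : Set G).PairwiseDisjoint T := by
    intro δ hδ δ' hδ' hne
    refine Finset.disjoint_left.2 fun z hzδ hzδ' => hne ?_
    simp only [T, Finset.mem_erase, Finset.mem_image] at hzδ hzδ'
    obtain ⟨h₂, h₁, ⟨z, r⟩, hr, rfl⟩ := hzδ
    obtain ⟨-, -, ⟨z', s⟩, hs, h⟩ := hzδ'
    simp only at h
    subst h
    rw [← hcd δ hδ, ← hcd δ' hδ']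
    exact hdisj z₁ z₂ hz _ _ _ _ (hc₁ δ hδ) (hc₂ δ hδ) (hc₁ δ' hδ') (hc₂ δ' hδ') _ _ _
      h₁ h₂ hr hs
  have subT : D.biUnion T ⊆ (Z.erase z₁).erase z₂ := by
    refine Finset.biUnion_subset.2 fun δ hδ => ?_
    exact Finset.erase_subset_erase _ (Finset.erase_subset_erase _ (Finset.image_subset_image
      (hL _ (hc₁ δ hδ) _ (hc₂ δ hδ) hz).2.2.1))
  have hle := Finset.card_le_card subT
  have m₁ : z₁ ∈ Z := Finset.mem_image.2 ⟨_, ha, rfl⟩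
  have m₂ : z₂ ∈ Z.erase z₁ := Finset.mem_erase.2 ⟨hz.symm, Finset.mem_image.2 ⟨_, hb, rfl⟩⟩
  rw [Finset.card_biUnion disjT, Finset.sum_const_nat cardT, Finset.card_erase_of_mem m₂,
    Finset.card_erase_of_mem m₁, hZcard] at hle
  have hDq : D.card ≤ q := by
    by_contra! h
    obtain ⟨k, rfl⟩ : ∃ k, q = k + 1 := ⟨q - 1, by omega⟩
    have h₁ : (k + 1 + 1) * k ≤ D.card * k := Nat.mul_le_mul_right _ h
    have h₂ : (k + 1) ^ 2 - 1 - 1 < (k + 1 + 1) * k := by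
      have : (k + 1) ^ 2 = (k + 1 + 1) * k + 1 := by ring
      rw [this]
      have : 0 < (k + 1 + 1) * k := Nat.mul_pos (by omega) (by omega)
      omega
    simp only [Nat.add_sub_cancel] at hle
    omega
  have himg : (A z₁).image (fun r => r - b') = D := by
    refine Finset.eq_of_subset_of_card_le ?_ ?_
    · intro δ hδ
      obtain ⟨r, hr, rfl⟩ := Finset.mem_image.1 hδ
      exact Finset.mem_image.2 ⟨(r, b'), Finset.mem_product.2 ⟨hr, (memA _ _).2 hb'⟩, rfl⟩
    · rw [Finset.card_image_of_injective _ (fun x y h => sub_left_injective h), cardA _ _ ha]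
      exact hDq
  have hab : a - b ∈ D :=
    Finset.mem_image.2 ⟨(a, b), Finset.mem_product.2 ⟨(memA _ _).2 ha, (memA _ _).2 hb⟩, rfl⟩
  rw [← himg] at hab
  obtain ⟨r, hr, h⟩ := Finset.mem_image.1 hab
  rw [← h, sub_add_cancel]
  exact (memA _ _).1 hr

/-- In the situation of `fiber_add_sub_mem`, the difference of two points of one fibre
translates `W` into itself. -/
theorem fiber_translate_mem {F G : Type*} [DecidableEq F] [DecidableEq G] [AddCommGroup G]
    (W : Finset (F × G)) (q : ℕ) (hq : 2 ≤ q) (hcard : W.card = q ^ 3)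
    (hfib : ∀ w ∈ W, (W.filter (fun w' => w'.1 = w.1)).card = q)
    (hmem : ∀ z₁ z₂ : F, z₁ ≠ z₂ → ∀ a b b' : G, (z₁, a) ∈ W → (z₂, b) ∈ W → (z₂, b') ∈ W →
      (z₁, a - b + b') ∈ W)
    {z₀ : F} {r₀ r₁ : G} (h₀ : (z₀, r₀) ∈ W) (h₁ : (z₀, r₁) ∈ W) {z : F} {r : G}
    (h : (z, r) ∈ W) : (z, r - r₀ + r₁) ∈ W := by
  by_cases hz : z = z₀
  · subst hz
    obtain ⟨⟨z', s⟩, hw, hne⟩ : ∃ w ∈ W, w.1 ≠ z := by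
      by_contra! hall
      have := hfib _ h
      rw [Finset.filter_true_of_mem hall, hcard] at this
      nlinarith [Nat.mul_le_mul hq hq, pow_succ q 2, pow_two q]
    have h' := hmem z' z hne s r₀ r₁ hw h₀ h₁
    have h'' := hmem z z' (Ne.symm hne) r s _ h hw h'
    convert h'' using 2
    abel
  · exact hmem z z₀ hz r r₀ r₁ h h₀ h₁

open scoped LinearAlgebra.Projectivization

section Field

variable {C : Type*} [Field C] {R : Subfield C} {σ : C →+* C} {ε t d : C}

/-- A degree two extension is spanned by `1` and any element outside the base field. -/
theorem exists_add_mul_eq (hrank : Module.finrank R C = 2) (hε : ε ∉ R) (w : C) :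
    ∃ a ∈ R, ∃ b ∈ R, w = a + ε * b := by
  have hli : LinearIndependent R ![(1 : C), ε] := by
    rw [LinearIndependent.pair_iff' one_ne_zero]
    intro a ha
    apply hε
    rw [← ha, Subfield.smul_def, smul_eq_mul, mul_one]
    exact a.2
  have hspan := hli.span_eq_top_of_card_eq_finrank (by simp [hrank])
  have hw : w ∈ Submodule.span R (Set.range ![(1 : C), ε]) := hspan ▸ Submodule.mem_top
  rw [Matrix.range_cons, Matrix.range_cons, Matrix.range_empty, Set.union_empty,
    Set.singleton_union, Submodule.mem_span_pair] at hw
  obtain ⟨a, b, rfl⟩ := hw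
  exact ⟨a, a.2, b, b.2, by simp [Subfield.smul_def, mul_comm]⟩

/-- The data of the separable or inseparable quadratic extension `C|R` with its standard
generator `ε`. -/
structure QuadData (R : Subfield C) (σ : C →+* C) (ε t d : C) : Prop where
  rank : Module.finrank R C = 2
  eps : ε ∉ R
  t_mem : t ∈ R
  d_mem : d ∈ R
  min : ε ^ 2 - t * ε + d = 0
  fix : ∀ r ∈ R, σ r = r
  map_eps : σ ε = t - ε

namespace QuadData

variable (h : QuadData R σ ε t d)
include h

theorem decomp (w : C) : ∃ a ∈ R, ∃ b ∈ R, w = a + ε * b :=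
  exists_add_mul_eq h.rank h.eps w

theorem eps_ne_zero : ε ≠ 0 := fun h0 => h.eps (h0 ▸ R.zero_mem)

theorem eps_mul_map : ε * σ ε = d := by
  rw [h.map_eps]
  linear_combination -h.min

theorem map_map (w : C) : σ (σ w) = w := by
  obtain ⟨a, ha, b, hb, rfl⟩ := h.decomp w
  simp only [map_add, map_mul, h.fix a ha, h.fix b hb, h.map_eps, map_sub, h.fix t h.t_mem]
  ring

theorem trace_mem (w : C) : w + σ w ∈ R := by
  obtain ⟨a, ha, b, hb, rfl⟩ := h.decomp w
  simp only [map_add, map_mul, h.fix a ha, h.fix b hb, h.map_eps]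
  convert R.add_mem (R.add_mem ha ha) (R.mul_mem h.t_mem hb) using 1
  ring

theorem norm_mem (w : C) : σ w * w ∈ R := by
  obtain ⟨a, ha, b, hb, rfl⟩ := h.decomp w
  simp only [map_add, map_mul, h.fix a ha, h.fix b hb, h.map_eps]
  convert R.add_mem (R.add_mem (R.mul_mem ha ha) (R.mul_mem (R.mul_mem h.t_mem ha) hb))
    (R.mul_mem h.d_mem (R.mul_mem hb hb)) using 1
  linear_combination -(b * b) * h.min

theorem eq_zero_of_mem {r s : C} (hr : r ∈ R) (hs : s ∈ R) (hrs : r = ε * s) : r = 0 ∧ s = 0 := by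
  by_cases h0 : s = 0
  · exact ⟨by rw [hrs, h0, mul_zero], h0⟩
  · exact absurd (by rw [hrs, mul_div_cancel_right₀ _ h0] : r / s = ε) fun he =>
      h.eps (he ▸ R.div_mem hr hs)

end QuadData

end Field

section Vectors

variable {C : Type*} [Field C] {R : Subfield C} {σ : C →+* C} {ε t d : C}

/-- The equation of the generalized hermitian unital on vectors. -/
def IsHermVec (R : Subfield C) (σ : C →+* C) (ε : C) (v : Fin 3 → C) : Prop :=
  ∃ r ∈ R, σ (v 0) * v 1 + σ (v 2) * v 2 = ε * r

theorem QuadData.isHermVec_smul (h : QuadData R σ ε t d) {v : Fin 3 → C}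
    (hv : IsHermVec R σ ε v) (c : C) : IsHermVec R σ ε (c • v) := by
  obtain ⟨r, hr, e⟩ := hv
  refine ⟨σ c * c * r, R.mul_mem (h.norm_mem c) hr, ?_⟩
  simp only [Pi.smul_apply, smul_eq_mul, map_mul]
  linear_combination σ c * c * e

theorem QuadData.mk_mem_hermSet (h : QuadData R σ ε t d) {v : Fin 3 → C} (hv : v ≠ 0) :
    Projectivization.mk C v hv ∈ hermSet R σ ε ↔ IsHermVec R σ ε v := by
  constructor
  · rintro ⟨w, hw, e, hr⟩
    obtain ⟨a, rfl⟩ := (Projectivization.mk_eq_mk_iff' C v w hv hw).1 e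
    exact h.isHermVec_smul hr a
  · intro hr
    exact ⟨v, hv, rfl, hr⟩

theorem mk_rep_eq_zero_iff (f : (Fin 3 → C) →ₗ[C] C) {v : Fin 3 → C} (hv : v ≠ 0) :
    f (Projectivization.mk C v hv).rep = 0 ↔ f v = 0 := by
  obtain ⟨a, ha⟩ := Projectivization.exists_smul_eq_mk_rep C v hv
  rw [← ha, Units.smul_def, map_smul, smul_eq_mul, mul_eq_zero, or_iff_right a.ne_zero]

/-- The shear `[X, Y, Z] ↦ [X, Y + aX + bZ, Z + cX]`, which fixes the point `[0, 1, 0]`. -/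
def shear (a b c : C) : (Fin 3 → C) ≃ₗ[C] (Fin 3 → C) where
  toFun v := ![v 0, v 1 + a * v 0 + b * v 2, v 2 + c * v 0]
  invFun v := ![v 0, v 1 - (a - b * c) * v 0 - b * v 2, v 2 - c * v 0]
  map_add' v w := by
    ext i; fin_cases i <;> simp <;> ring
  map_smul' r v := by
    ext i; fin_cases i <;> simp <;> ring
  left_inv v := by
    ext i; fin_cases i <;> simp; ring
  right_inv v := by
    ext i; fin_cases i <;> simp; ring

theorem shear_apply (a b c : C) (v : Fin 3 → C) :
    shear a b c v = ![v 0, v 1 + a * v 0 + b * v 2, v 2 + c * v 0] := rfl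

/-- The map `[X, Y, Z] ↦ [Y, kX, Z]`, which interchanges `[1, 0, 0]` and `[0, 1, 0]`. -/
def swap (k : C) (hk : k ≠ 0) : (Fin 3 → C) ≃ₗ[C] (Fin 3 → C) where
  toFun v := ![v 1, k * v 0, v 2]
  invFun v := ![k⁻¹ * v 1, v 0, v 2]
  map_add' v w := by
    ext i; fin_cases i <;> simp; ring
  map_smul' r v := by
    ext i; fin_cases i <;> simp; ring
  left_inv v := by
    ext i; fin_cases i <;> simp [hk]
  right_inv v := by
    ext i; fin_cases i <;> simp [hk]

theorem swap_apply (k : C) (hk : k ≠ 0) (v : Fin 3 → C) :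
    swap k hk v = ![v 1, k * v 0, v 2] := rfl

/-- Vectors whose forms differ by an element of `εR` satisfy the equation simultaneously. -/
theorem isHermVec_congr {v w : Fin 3 → C} {s : C} (hs : s ∈ R)
    (e : σ (w 0) * w 1 + σ (w 2) * w 2 = σ (v 0) * v 1 + σ (v 2) * v 2 + ε * s) :
    IsHermVec R σ ε w ↔ IsHermVec R σ ε v := by
  constructor
  · rintro ⟨r, hr, e'⟩
    exact ⟨r - s, R.sub_mem hr hs, by linear_combination e' - e⟩
  · rintro ⟨r, hr, e'⟩
    exact ⟨r + s, R.add_mem hr hs, by linear_combination e' + e⟩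

theorem QuadData.isHermVec_shear (h : QuadData R σ ε t d) {r : C} (hr : r ∈ R) (c : C)
    (v : Fin 3 → C) :
    IsHermVec R σ ε (shear (ε * r - σ c * c) (σ c * (ε / σ ε - 1)) c v) ↔ IsHermVec R σ ε v := by
  have hε := h.eps_ne_zero
  have hσε : σ ε ≠ 0 := (map_ne_zero σ).2 hε
  have key : c * v 0 * σ (v 2) + σ c * (ε / σ ε) * σ (v 0) * v 2 =
      ε * (σ c * σ (v 0) * v 2 / σ ε + σ (σ c * σ (v 0) * v 2 / σ ε)) := by
    simp only [map_mul, map_div₀, h.map_map]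
    field_simp
    ring
  refine isHermVec_congr (R.add_mem (h.trace_mem (σ c * σ (v 0) * v 2 / σ ε))
    (R.mul_mem (h.norm_mem (v 0)) hr)) ?_
  simp only [shear_apply, Matrix.cons_val_zero, Matrix.cons_val_one, Matrix.cons_val, map_add,
    map_mul]
  linear_combination key

theorem QuadData.isHermVec_swap (h : QuadData R σ ε t d) (hk : -ε / σ ε ≠ 0) (v : Fin 3 → C) :
    IsHermVec R σ ε (swap (-ε / σ ε) hk v) ↔ IsHermVec R σ ε v := by
  have hε := h.eps_ne_zero
  have hσε : σ ε ≠ 0 := (map_ne_zero σ).2 hε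
  have hd : d ≠ 0 := h.eps_mul_map ▸ mul_ne_zero hε hσε
  have hsum : ε + σ ε = t := by rw [h.map_eps]; ring
  have hn := h.norm_mem (v 2)
  simp only [IsHermVec, swap_apply, Matrix.cons_val_zero, Matrix.cons_val_one, Matrix.cons_val]
  constructor
  · rintro ⟨r, hr, e⟩
    refine ⟨σ (v 2) * v 2 * (t / d) - r, R.sub_mem (R.mul_mem hn (R.div_mem h.t_mem h.d_mem)) hr, ?_⟩
    have e' := congrArg σ e
    simp only [map_mul, map_add, map_div₀, map_neg, h.map_map, h.fix r hr] at e'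
    rw [← h.eps_mul_map, ← hsum]
    field_simp at e' ⊢
    linear_combination -e'
  · rintro ⟨r, hr, e⟩
    refine ⟨σ (v 2) * v 2 * (t / d) - r, R.sub_mem (R.mul_mem hn (R.div_mem h.t_mem h.d_mem)) hr, ?_⟩
    have e' := congrArg σ e
    simp only [map_mul, map_add, h.map_map, h.fix r hr] at e'
    rw [← h.eps_mul_map, ← hsum]
    field_simp
    linear_combination -ε * e'

end Vectors

section Collineations

open scoped Pointwise

variable {C : Type*} [Field C] {R : Subfield C} {σ : C →+* C} {ε t d : C}

/-- A linear automorphism leaving the equation of the generalized hermitian unital invariant. -/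
def PreservesHerm (R : Subfield C) (σ : C →+* C) (ε : C)
    (g : (Fin 3 → C) ≃ₗ[C] (Fin 3 → C)) : Prop :=
  ∀ v, IsHermVec R σ ε (g v) ↔ IsHermVec R σ ε v

theorem PreservesHerm.inv {g : (Fin 3 → C) ≃ₗ[C] (Fin 3 → C)} (hg : PreservesHerm R σ ε g) :
    PreservesHerm R σ ε g⁻¹ := fun v => by
  rw [← hg (g⁻¹ v)]
  exact iff_of_eq (congrArg _ (g.apply_symm_apply v))

theorem smul_lineSet (g : (Fin 3 → C) ≃ₗ[C] (Fin 3 → C)) (f : (Fin 3 → C) →ₗ[C] C) :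
    g • {P : ℙ C (Fin 3 → C) | f P.rep = 0} =
      {P : ℙ C (Fin 3 → C) | (f ∘ₗ g.symm.toLinearMap) P.rep = 0} := by
  ext P
  induction P using Projectivization.ind with | h v hv =>
  rw [Set.mem_smul_set_iff_inv_smul_mem, Projectivization.smul_mk, Set.mem_ofPred_eq,
    Set.mem_ofPred_eq, mk_rep_eq_zero_iff, mk_rep_eq_zero_iff]
  rfl

theorem IsLine.smul (g : (Fin 3 → C) ≃ₗ[C] (Fin 3 → C)) {ℓ : Set (ℙ C (Fin 3 → C))}
    (hℓ : IsLine C ℓ) : IsLine C (g • ℓ) := by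
  obtain ⟨f, hf, rfl⟩ := hℓ
  refine ⟨f ∘ₗ g.symm.toLinearMap, fun h0 => hf ?_, smul_lineSet g f⟩
  refine LinearMap.ext fun v => ?_
  simpa using LinearMap.congr_fun h0 (g v)

theorem QuadData.smul_hermSet (h : QuadData R σ ε t d) {g : (Fin 3 → C) ≃ₗ[C] (Fin 3 → C)}
    (hg : PreservesHerm R σ ε g) : g • hermSet R σ ε = hermSet R σ ε := by
  ext P
  induction P using Projectivization.ind with | h v hv =>
  rw [Set.mem_smul_set_iff_inv_smul_mem, Projectivization.smul_mk, h.mk_mem_hermSet,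
    h.mk_mem_hermSet]
  exact hg.inv v

theorem QuadData.isHermBlock_smul (h : QuadData R σ ε t d)
    {g : (Fin 3 → C) ≃ₗ[C] (Fin 3 → C)} (hg : PreservesHerm R σ ε g)
    {B : Set (ℙ C (Fin 3 → C))} (hB : IsHermBlock R σ ε B) : IsHermBlock R σ ε (g • B) := by
  obtain ⟨ℓ, hℓ, hn, rfl⟩ := hB
  have e : g • (hermSet R σ ε ∩ ℓ) = hermSet R σ ε ∩ g • ℓ := by
    rw [Set.smul_set_inter, h.smul_hermSet hg]
  exact ⟨g • ℓ, hℓ.smul g, e ▸ hn.image (MulAction.injective g), e⟩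

theorem QuadData.isUnitalAuto_smul (h : QuadData R σ ε t d)
    {g : (Fin 3 → C) ≃ₗ[C] (Fin 3 → C)} (hg : PreservesHerm R σ ε g) :
    IsUnitalAuto (hermSet R σ ε) (IsHermBlock R σ ε) (fun P : ℙ C (Fin 3 → C) => g • P) := by
  refine ⟨?_, fun B hB => h.isHermBlock_smul hg hB, fun B hB =>
    ⟨g⁻¹ • B, h.isHermBlock_smul hg.inv hB, smul_inv_smul g B⟩⟩
  have := (MulAction.injective g).injOn.bijOn_image (s := hermSet R σ ε)
  rwa [Set.image_smul, h.smul_hermSet hg] at this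

theorem QuadData.isSubunital_smul (h : QuadData R σ ε t d)
    {g : (Fin 3 → C) ≃ₗ[C] (Fin 3 → C)} (hg : PreservesHerm R σ ε g) {q : ℕ}
    {U : Set (ℙ C (Fin 3 → C))} (hU : IsSubunital R σ ε q U) : IsSubunital R σ ε q (g • U) := by
  obtain ⟨hsub, hcard, hB⟩ := hU
  refine ⟨?_, ?_, fun B hBl hn => ?_⟩
  · rw [← h.smul_hermSet hg]
    exact Set.smul_set_mono hsub
  · rw [← hcard]
    exact Set.ncard_image_of_injective U (MulAction.injective g)
  · have e : B ∩ g • U = g • (g⁻¹ • B ∩ U) := by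
      rw [Set.smul_set_inter, smul_inv_smul]
    rw [e] at hn ⊢
    rw [← hB _ (h.isHermBlock_smul hg.inv hBl) (Set.nontrivial_of_image _ _ hn)]
    exact Set.ncard_image_of_injective _ (MulAction.injective g)

/-- For every subunital through `p`, any two of its points on a block through `p` are related by
a translation with center `p` preserving the subunital. -/
def HasSubunitalTranslations (R : Subfield C) (σ : C →+* C) (ε : C) (q : ℕ)
    (p : ℙ C (Fin 3 → C)) : Prop :=
  ∀ U, IsSubunital R σ ε q U → p ∈ U → ∀ x₀ ∈ U, ∀ x ∈ U, x₀ ≠ p → x ≠ p →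
    (∃ B, IsHermBlock R σ ε B ∧ p ∈ B ∧ x₀ ∈ B ∧ x ∈ B) →
    ∃ τ, IsTranslation (hermSet R σ ε) (IsHermBlock R σ ε) p τ ∧ τ x₀ = x ∧ τ '' U = U

theorem QuadData.hasSubunitalTranslations_of_smul (h : QuadData R σ ε t d)
    {g : (Fin 3 → C) ≃ₗ[C] (Fin 3 → C)} (hg : PreservesHerm R σ ε g) {q : ℕ}
    {p : ℙ C (Fin 3 → C)} (hp : HasSubunitalTranslations R σ ε q (g • p)) :
    HasSubunitalTranslations R σ ε q p := by
  rintro U hU hpU x₀ hx₀ x hx hx₀p hxp ⟨B, hB, hpB, hx₀B, hxB⟩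
  obtain ⟨τ, ⟨⟨hbij, him, hsurj⟩, hfix, hblock⟩, hτx, hτU⟩ := hp (g • U) (h.isSubunital_smul hg hU)
    (Set.smul_mem_smul_set hpU) (g • x₀) (Set.smul_mem_smul_set hx₀) (g • x)
    (Set.smul_mem_smul_set hx) ((MulAction.injective g).ne hx₀p) ((MulAction.injective g).ne hxp)
    ⟨g • B, h.isHermBlock_smul hg hB, Set.smul_mem_smul_set hpB, Set.smul_mem_smul_set hx₀B,
      Set.smul_mem_smul_set hxB⟩
  have himage : ∀ S : Set (ℙ C (Fin 3 → C)),
      (fun P => g⁻¹ • τ (g • P)) '' S = g⁻¹ • (τ '' (g • S)) := fun S => by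
    rw [← Set.image_smul, ← Set.image_smul, Set.image_image, Set.image_image]
  refine ⟨fun P => g⁻¹ • τ (g • P), ⟨⟨?_, ?_, ?_⟩, ?_, ?_⟩, ?_, ?_⟩
  · exact (h.isUnitalAuto_smul hg.inv).1.comp (hbij.comp (h.isUnitalAuto_smul hg).1)
  · intro B hB
    rw [himage]
    exact h.isHermBlock_smul hg.inv (him _ (h.isHermBlock_smul hg hB))
  · intro B hB
    obtain ⟨B', hB', e⟩ := hsurj _ (h.isHermBlock_smul hg hB)
    exact ⟨g⁻¹ • B', h.isHermBlock_smul hg.inv hB', by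
      rw [himage, smul_inv_smul, e, inv_smul_smul]⟩
  · simp only [hfix, inv_smul_smul]
  · intro B hB hpB
    rw [himage, hblock _ (h.isHermBlock_smul hg hB) (Set.smul_mem_smul_set hpB), inv_smul_smul]
  · simp only [hτx, inv_smul_smul]
  · rw [himage, hτU, inv_smul_smul]

/-- The point `[0, 1, 0]`. -/
def infPt (C : Type*) [Field C] : ℙ C (Fin 3 → C) :=
  Projectivization.mk C ![0, 1, 0] fun h => one_ne_zero (congrFun h 1)

/-- The point `[1, εr - σ(z)z, z]` of the unital, for `r ∈ R`. -/
def affPt (σ : C →+* C) (ε : C) (w : C × C) : ℙ C (Fin 3 → C) :=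
  Projectivization.mk C ![1, ε * w.2 - σ w.1 * w.1, w.1] fun h => one_ne_zero (congrFun h 0)

theorem affPt_ne_infPt (w : C × C) : affPt σ ε w ≠ infPt C := by
  intro e
  obtain ⟨a, ha⟩ := (Projectivization.mk_eq_mk_iff' C _ _ _ _).1 e
  simpa using congrFun ha 0

theorem affPt_injective (hε : ε ≠ 0) : Function.Injective (affPt σ ε) := by
  rintro ⟨z, r⟩ ⟨z', r'⟩ e
  obtain ⟨a, ha⟩ := (Projectivization.mk_eq_mk_iff' C _ _ _ _).1 e
  have h0 : a = 1 := by simpa using congrFun ha 0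
  subst h0
  have h2 : z' = z := by simpa using congrFun ha 2
  subst h2
  have h1 : r' = r := by simpa [hε] using congrFun ha 1
  rw [h1]

theorem QuadData.eq_infPt_or_affPt (h : QuadData R σ ε t d) {P : ℙ C (Fin 3 → C)}
    (hP : P ∈ hermSet R σ ε) : P = infPt C ∨ ∃ w : C × C, w.2 ∈ R ∧ P = affPt σ ε w := by
  induction P using Projectivization.ind with | h v hv =>
  rw [h.mk_mem_hermSet] at hP
  by_cases h0 : v 0 = 0
  · left
    obtain ⟨r, hr, e⟩ := hP
    rw [h0, map_zero, zero_mul, zero_add] at e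
    have h2 : v 2 = 0 := by
      have := (h.eq_zero_of_mem (h.norm_mem _) hr e).1
      simpa using this
    refine (Projectivization.mk_eq_mk_iff' C _ _ _ _).2 ⟨v 1, ?_⟩
    ext i
    fin_cases i <;> simp [h0, h2]
  · right
    obtain ⟨r, hr, e⟩ := h.isHermVec_smul hP (v 0)⁻¹
    refine ⟨((v 0)⁻¹ * v 2, r), hr, (Projectivization.mk_eq_mk_iff' C _ _ _ _).2 ⟨v 0, ?_⟩⟩
    simp only [Pi.smul_apply, smul_eq_mul, inv_mul_cancel₀ h0, map_one, one_mul] at e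
    ext i
    fin_cases i
    · simp
    · simp only [Fin.mk_one, Pi.smul_apply, Matrix.cons_val_one, smul_eq_mul, ← e,
        add_sub_cancel_right, Matrix.cons_val_zero]
      exact mul_inv_cancel_left₀ h0 _
    · simp [h0]

theorem QuadData.affPt_mem (h : QuadData R σ ε t d) {w : C × C} (hw : w.2 ∈ R) :
    affPt σ ε w ∈ hermSet R σ ε :=
  (h.mk_mem_hermSet _).2 ⟨w.2, hw, by simp⟩

theorem QuadData.infPt_mem (h : QuadData R σ ε t d) : infPt C ∈ hermSet R σ ε :=
  (h.mk_mem_hermSet _).2 ⟨0, R.zero_mem, by simp⟩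

/-- The linear form `v ↦ a * v 0 + b * v 1 + c * v 2`. -/
def linForm (a b c : C) : (Fin 3 → C) →ₗ[C] C :=
  a • LinearMap.proj 0 + b • LinearMap.proj 1 + c • LinearMap.proj 2

theorem linForm_apply (a b c : C) (v : Fin 3 → C) :
    linForm a b c v = a * v 0 + b * v 1 + c * v 2 := rfl

theorem exists_eq_linForm (f : (Fin 3 → C) →ₗ[C] C) : ∃ a b c, f = linForm a b c := by
  refine ⟨f (Pi.single 0 1), f (Pi.single 1 1), f (Pi.single 2 1), ?_⟩
  ext i
  fin_cases i <;> simp [linForm_apply]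

/-- The block consisting of `[0, 1, 0]` and all points with affine coordinate `z`. -/
theorem QuadData.isHermBlock_vertical (h : QuadData R σ ε t d) (z : C) :
    IsHermBlock R σ ε (insert (infPt C) (affPt σ ε '' {w | w.1 = z ∧ w.2 ∈ R})) := by
  have hf : linForm (-z) 0 (1 : C) ≠ 0 := fun h0 => by
    simpa [linForm_apply] using LinearMap.congr_fun h0 ![0, 0, 1]
  have e : insert (infPt C) (affPt σ ε '' {w | w.1 = z ∧ w.2 ∈ R}) =
      hermSet R σ ε ∩ {P | linForm (-z) 0 (1 : C) P.rep = 0} := by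
    ext P
    constructor
    · rintro (rfl | ⟨w, ⟨hz, hr⟩, rfl⟩)
      · exact ⟨h.infPt_mem, (mk_rep_eq_zero_iff _ _).2 (by simp [linForm_apply])⟩
      · exact ⟨h.affPt_mem hr, (mk_rep_eq_zero_iff _ _).2 (by simp [linForm_apply, hz])⟩
    · rintro ⟨hP, hl⟩
      rcases h.eq_infPt_or_affPt hP with rfl | ⟨w, hr, rfl⟩
      · exact Or.inl rfl
      · refine Or.inr ⟨w, ⟨?_, hr⟩, rfl⟩
        have := (mk_rep_eq_zero_iff _ _).1 hl
        simp only [linForm_apply, Matrix.cons_val] at this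
        linear_combination this
  refine ⟨_, ⟨_, hf, rfl⟩, ?_, e⟩
  rw [← e]
  exact ⟨infPt C, Or.inl rfl, affPt σ ε (z, 0), Or.inr ⟨_, ⟨rfl, R.zero_mem⟩, rfl⟩,
    (affPt_ne_infPt _).symm⟩

/-- Collinearity of the points with affine coordinates `w₁`, `w₂`, `w`. -/
def OnChord (σ : C →+* C) (ε : C) (w₁ w₂ w : C × C) : Prop :=
  (ε * w.2 - σ w.1 * w.1 - (ε * w₁.2 - σ w₁.1 * w₁.1)) * (w₂.1 - w₁.1) =
    (ε * w₂.2 - σ w₂.1 * w₂.1 - (ε * w₁.2 - σ w₁.1 * w₁.1)) * (w.1 - w₁.1)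

/-- The block joining two points with distinct first affine coordinates. -/
theorem QuadData.isHermBlock_chord (h : QuadData R σ ε t d) {w₁ w₂ : C × C} (h₁ : w₁.2 ∈ R)
    (h₂ : w₂.2 ∈ R) (hne : w₁.1 ≠ w₂.1) :
    IsHermBlock R σ ε (affPt σ ε '' {w | w.2 ∈ R ∧ OnChord σ ε w₁ w₂ w}) := by
  set y₁ := ε * w₁.2 - σ w₁.1 * w₁.1 with hy₁
  set y₂ := ε * w₂.2 - σ w₂.1 * w₂.1 with hy₂
  let f := linForm (-y₁ * (w₂.1 - w₁.1) + (y₂ - y₁) * w₁.1) (w₂.1 - w₁.1) (-(y₂ - y₁))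
  have hne' : w₂.1 - w₁.1 ≠ 0 := sub_ne_zero.2 hne.symm
  have hf : f ≠ 0 := fun h0 => hne' <| by
    simpa [f, linForm_apply] using LinearMap.congr_fun h0 ![0, 1, 0]
  have e : affPt σ ε '' {w | w.2 ∈ R ∧ OnChord σ ε w₁ w₂ w} =
      hermSet R σ ε ∩ {P | f P.rep = 0} := by
    ext P
    constructor
    · rintro ⟨w, ⟨hr, hj⟩, rfl⟩
      refine ⟨h.affPt_mem hr, (mk_rep_eq_zero_iff _ _).2 ?_⟩
      simp only [OnChord, ← hy₁, ← hy₂] at hj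
      simp only [f, linForm_apply, Matrix.cons_val]
      linear_combination hj
    · rintro ⟨hP, hl⟩
      rcases h.eq_infPt_or_affPt hP with rfl | ⟨w, hr, rfl⟩
      · refine absurd ?_ hne'
        have := (mk_rep_eq_zero_iff _ _).1 hl
        simpa [f, linForm_apply] using this
      · refine ⟨w, ⟨hr, ?_⟩, rfl⟩
        have := (mk_rep_eq_zero_iff _ _).1 hl
        simp only [f, linForm_apply, Matrix.cons_val] at this
        simp only [OnChord, ← hy₁, ← hy₂]
        linear_combination this
  refine ⟨_, ⟨_, hf, rfl⟩, ?_, e⟩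
  rw [← e]
  exact ⟨_, ⟨w₁, ⟨h₁, by simp [OnChord]⟩, rfl⟩, _, ⟨w₂, ⟨h₂, by simp [OnChord]⟩, rfl⟩,
    fun h0 => hne (congrArg Prod.fst (affPt_injective h.eps_ne_zero h0))⟩

theorem OnChord.eq_of_fst_eq {w₁ w₂ w w' : C × C} (hε : ε ≠ 0) (hne : w₁.1 ≠ w₂.1)
    (hw : OnChord σ ε w₁ w₂ w) (hw' : OnChord σ ε w₁ w₂ w') (e : w.1 = w'.1) : w = w' := by
  unfold OnChord at hw hw'
  rw [e] at hw
  have hne' : w₂.1 - w₁.1 ≠ 0 := sub_ne_zero.2 hne.symm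
  have : ε * (w₂.1 - w₁.1) * (w.2 - w'.2) = 0 := by linear_combination hw - hw'
  refine Prod.ext e (sub_eq_zero.1 ?_)
  exact (mul_eq_zero.1 this).resolve_left (mul_ne_zero hε hne')

/-- Two blocks over the same pair of coordinates with a common third coordinate have the same
slope. -/
theorem QuadData.sub_eq_sub_of_onChord (h : QuadData R σ ε t d) {z₁ z₂ z r₁ r₂ s₁ s₂ r s : C}
    (hz₁₂ : z₁ ≠ z₂) (hz₁ : z ≠ z₁) (hz₂ : z ≠ z₂) (hr₁ : r₁ ∈ R) (hr₂ : r₂ ∈ R) (hs₁ : s₁ ∈ R)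
    (hs₂ : s₂ ∈ R) (hr : r ∈ R) (hs : s ∈ R) (hj : OnChord σ ε (z₁, r₁) (z₂, r₂) (z, r))
    (hj' : OnChord σ ε (z₁, s₁) (z₂, s₂) (z, s)) : r₁ - r₂ = s₁ - s₂ := by
  by_contra hne
  simp only [OnChord] at hj hj'
  have hε := h.eps_ne_zero
  have hz : z₂ - z₁ ≠ 0 := sub_ne_zero.2 hz₁₂.symm
  set D := r₂ - s₂ - (r₁ - s₁) with hD
  have hD0 : D ≠ 0 := fun h0 => hne (by linear_combination hD - h0)
  have key : (r - s - (r₁ - s₁)) * (z₂ - z₁) = D * (z - z₁) :=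
    mul_left_cancel₀ hε (by rw [hD]; linear_combination hj - hj')
  obtain ⟨l, hl, hzl⟩ : ∃ l ∈ R, z = z₁ + l * (z₂ - z₁) := by
    refine ⟨(r - s - (r₁ - s₁)) / D, R.div_mem (R.sub_mem (R.sub_mem hr hs) (R.sub_mem hr₁ hs₁))
      (R.sub_mem (R.sub_mem hr₂ hs₂) (R.sub_mem hr₁ hs₁)), ?_⟩
    field_simp
    linear_combination -key
  obtain ⟨w, rfl⟩ : ∃ w, z₂ = z₁ + w := ⟨z₂ - z₁, by ring⟩
  rw [add_sub_cancel_left] at hz hzl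
  subst hzl
  simp only [map_add, map_mul, h.fix l hl] at hj
  have e : (l - l * l) * (σ w * w) = ε * (l * (r₂ - r₁) - (r - r₁)) :=
    mul_left_cancel₀ hz (by linear_combination hj)
  have hR : l * (r₂ - r₁) - (r - r₁) ∈ R :=
    R.sub_mem (R.mul_mem hl (R.sub_mem hr₂ hr₁)) (R.sub_mem hr hr₁)
  have h0 := (h.eq_zero_of_mem (R.mul_mem (R.sub_mem hl (R.mul_mem hl hl)) (h.norm_mem w)) hR e).1
  have hσw : σ w * w ≠ 0 := mul_ne_zero ((map_ne_zero σ).2 hz) hz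
  have h1 : l * (1 - l) = 0 := by
    linear_combination (mul_eq_zero.1 h0).resolve_right hσw
  rcases mul_eq_zero.1 h1 with hl0 | hl1
  · exact hz₁ (by rw [hl0]; ring)
  · exact hz₂ (by linear_combination -w * hl1)

end Collineations

section Subunitals

open scoped Pointwise

variable {C : Type*} [Field C] {R : Subfield C} {σ : C →+* C} {ε t d : C}

open Classical in
/-- The affine coordinates of a subunital through `[0, 1, 0]` are closed under the translations
given by two of its points on a common vertical block. -/
theorem QuadData.affPt_translate_mem (h : QuadData R σ ε t d) {q : ℕ} (hq : 2 ≤ q)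
    {U : Set (ℙ C (Fin 3 → C))} (hU : IsSubunital R σ ε q U) (hinf : infPt C ∈ U)
    {z₀ r₀ r₁ : C} (hr₀ : r₀ ∈ R) (hr₁ : r₁ ∈ R) (h₀ : affPt σ ε (z₀, r₀) ∈ U)
    (h₁ : affPt σ ε (z₀, r₁) ∈ U) {z r : C} (hr : r ∈ R) (hz : affPt σ ε (z, r) ∈ U) :
    affPt σ ε (z, r - r₀ + r₁) ∈ U := by
  obtain ⟨hsub, hcard, hblock⟩ := hU
  have hinj := affPt_injective (σ := σ) h.eps_ne_zero
  have hUfin : U.Finite := Set.finite_of_ncard_ne_zero (by omega)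
  have hWfin : {w : C × C | w.2 ∈ R ∧ affPt σ ε w ∈ U}.Finite :=
    (hUfin.preimage hinj.injOn).subset fun w hw => hw.2
  obtain ⟨W, hW⟩ : ∃ W : Finset (C × C), ∀ w, w ∈ W ↔ w.2 ∈ R ∧ affPt σ ε w ∈ U :=
    ⟨hWfin.toFinset, fun w => by rw [Set.Finite.mem_toFinset]; rfl⟩
  have ncard_insert : ∀ S : Finset (C × C),
      (insert (infPt C) (affPt σ ε '' (S : Set (C × C)))).ncard = S.card + 1 := fun S => by
    rw [Set.ncard_insert_of_notMem, Set.ncard_image_of_injective _ hinj, Set.ncard_coe_finset]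
    rintro ⟨w, -, e⟩
    exact affPt_ne_infPt w e
  have hWcard : W.card = q ^ 3 := by
    have e : U = insert (infPt C) (affPt σ ε '' (W : Set (C × C))) := by
      ext P
      constructor
      · intro hP
        rcases h.eq_infPt_or_affPt (hsub hP) with rfl | ⟨w, hw, rfl⟩
        · exact Or.inl rfl
        · exact Or.inr ⟨w, (hW w).2 ⟨hw, hP⟩, rfl⟩
      · rintro (rfl | ⟨w, hw, rfl⟩)
        · exact hinf
        · exact ((hW w).1 hw).2
    rw [e, ncard_insert] at hcard
    omega
  have hfib : ∀ w ∈ W, (W.filter (fun w' => w'.1 = w.1)).card = q := by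
    intro w hw
    have e : insert (infPt C) (affPt σ ε '' {w' | w'.1 = w.1 ∧ w'.2 ∈ R}) ∩ U =
        insert (infPt C) (affPt σ ε '' (W.filter (fun w' => w'.1 = w.1) : Set (C × C))) := by
      ext P
      constructor
      · rintro ⟨rfl | ⟨w', ⟨hw₁, hw₂⟩, rfl⟩, hP⟩
        · exact Or.inl rfl
        · exact Or.inr ⟨w', Finset.mem_coe.2 (Finset.mem_filter.2 ⟨(hW w').2 ⟨hw₂, hP⟩, hw₁⟩), rfl⟩
      · rintro (rfl | ⟨w', hw', rfl⟩)
        · exact ⟨Or.inl rfl, hinf⟩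
        · obtain ⟨hm, hf⟩ := Finset.mem_filter.1 (Finset.mem_coe.1 hw')
          have hm' := (hW w').1 hm
          exact ⟨Or.inr ⟨w', ⟨hf, hm'.1⟩, rfl⟩, hm'.2⟩
    have hc := hblock _ (h.isHermBlock_vertical w.1) ⟨infPt C, ⟨Or.inl rfl, hinf⟩, affPt σ ε w,
      ⟨Or.inr ⟨w, ⟨rfl, ((hW w).1 hw).1⟩, rfl⟩, ((hW w).1 hw).2⟩, (affPt_ne_infPt w).symm⟩
    rw [e, ncard_insert] at hc
    omega
  have hmem : ∀ z₁ z₂ : C, z₁ ≠ z₂ → ∀ a b b' : C, (z₁, a) ∈ W → (z₂, b) ∈ W → (z₂, b') ∈ W →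
      (z₁, a - b + b') ∈ W := by
    intro z₁ z₂ hz a b b' ha hb hb'
    refine fiber_add_sub_mem W q hq hWcard hfib (fun w₁ w₂ => W.filter (OnChord σ ε w₁ w₂))
      ?_ ?_ hz ha hb hb'
    · intro w₁ hw₁ w₂ hw₂ hne
      have m₁ : w₁ ∈ W.filter (OnChord σ ε w₁ w₂) :=
        Finset.mem_filter.2 ⟨hw₁, by simp [OnChord]⟩
      have m₂ : w₂ ∈ W.filter (OnChord σ ε w₁ w₂) :=
        Finset.mem_filter.2 ⟨hw₂, by simp [OnChord]⟩
      have e : affPt σ ε '' {w | w.2 ∈ R ∧ OnChord σ ε w₁ w₂ w} ∩ U =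
          affPt σ ε '' (W.filter (OnChord σ ε w₁ w₂) : Set (C × C)) := by
        ext P
        constructor
        · rintro ⟨⟨w, ⟨hw, hj⟩, rfl⟩, hP⟩
          exact ⟨w, Finset.mem_coe.2 (Finset.mem_filter.2 ⟨(hW w).2 ⟨hw, hP⟩, hj⟩), rfl⟩
        · rintro ⟨w, hw, rfl⟩
          obtain ⟨hm, hj⟩ := Finset.mem_filter.1 (Finset.mem_coe.1 hw)
          have hm' := (hW w).1 hm
          exact ⟨⟨w, ⟨hm'.1, hj⟩, rfl⟩, hm'.2⟩
      have hc := hblock _ (h.isHermBlock_chord ((hW w₁).1 hw₁).1 ((hW w₂).1 hw₂).1 hne) (by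
        rw [e]
        exact ⟨_, ⟨w₁, m₁, rfl⟩, _, ⟨w₂, m₂, rfl⟩, fun e' => hne (congrArg Prod.fst (hinj e'))⟩)
      rw [e, Set.ncard_image_of_injective _ hinj, Set.ncard_coe_finset] at hc
      refine ⟨m₁, m₂, Finset.filter_subset _ _, hc, fun w hw w' hw' e' => ?_⟩
      exact (Finset.mem_filter.1 (Finset.mem_coe.1 hw)).2.eq_of_fst_eq h.eps_ne_zero hne
        (Finset.mem_filter.1 (Finset.mem_coe.1 hw')).2 e'
    · intro z₁ z₂ hz r₁ r₂ s₁ s₂ hr₁ hr₂ hs₁ hs₂ z r s hz₁ hz₂ hr hs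
      obtain ⟨hrW, hrj⟩ := Finset.mem_filter.1 hr
      obtain ⟨hsW, hsj⟩ := Finset.mem_filter.1 hs
      exact h.sub_eq_sub_of_onChord hz hz₁ hz₂ ((hW _).1 hr₁).1 ((hW _).1 hr₂).1 ((hW _).1 hs₁).1
        ((hW _).1 hs₂).1 ((hW _).1 hrW).1 ((hW _).1 hsW).1 hrj hsj
  exact ((hW _).1 (fiber_translate_mem W q hq hWcard hfib hmem ((hW _).2 ⟨hr₀, h₀⟩)
    ((hW _).2 ⟨hr₁, h₁⟩) ((hW _).2 ⟨hr, hz⟩))).2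

theorem QuadData.preservesHerm_shear (h : QuadData R σ ε t d) {r : C} (hr : r ∈ R) (c : C) :
    PreservesHerm R σ ε (shear (ε * r - σ c * c) (σ c * (ε / σ ε - 1)) c) :=
  h.isHermVec_shear hr c

theorem QuadData.preservesHerm_elation (h : QuadData R σ ε t d) {s : C} (hs : s ∈ R) :
    PreservesHerm R σ ε (shear (ε * s) 0 0) := by
  simpa using h.preservesHerm_shear hs 0

theorem elation_smul_infPt (s : C) : shear (ε * s) 0 0 • infPt C = infPt C := by
  rw [infPt, Projectivization.smul_mk]
  congr 1
  ext i
  fin_cases i <;> simp [LinearEquiv.smul_def, shear_apply]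

theorem elation_smul_affPt (s : C) (w : C × C) :
    shear (ε * s) 0 0 • affPt σ ε w = affPt σ ε (w.1, w.2 + s) := by
  rw [affPt, affPt, Projectivization.smul_mk]
  congr 1
  ext i
  fin_cases i <;> simp [LinearEquiv.smul_def, shear_apply]
  ring

/-- The maps `[X, Y, Z] ↦ [X, Y + εsX, Z]` are translations with center `[0, 1, 0]`. -/
theorem QuadData.isTranslation_elation (h : QuadData R σ ε t d) {s : C} (hs : s ∈ R) :
    IsTranslation (hermSet R σ ε) (IsHermBlock R σ ε) (infPt C)
      (fun P => shear (ε * s) 0 0 • P) := by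
  refine ⟨h.isUnitalAuto_smul (h.preservesHerm_elation hs), elation_smul_infPt s, ?_⟩
  rintro B ⟨ℓ, ⟨f, hf, rfl⟩, -, rfl⟩ hB
  rw [Set.image_smul, Set.smul_set_inter, h.smul_hermSet (h.preservesHerm_elation hs),
    smul_lineSet]
  have h0 : f ![0, 1, 0] = 0 := (mk_rep_eq_zero_iff _ _).1 hB.2
  suffices f ∘ₗ (shear (ε * s) 0 0).symm.toLinearMap = f by rw [this]
  refine LinearMap.ext fun v => ?_
  have e : (shear (ε * s) 0 0).symm v = v - (ε * s * v 0) • ![0, 1, 0] := by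
    rw [LinearEquiv.symm_apply_eq, shear_apply]
    ext i
    fin_cases i <;> simp
  rw [LinearMap.comp_apply, LinearEquiv.coe_coe, e, map_sub, map_smul, h0, smul_zero, sub_zero]

theorem fst_eq_of_mem_block {B : Set (ℙ C (Fin 3 → C))}
    (hB : IsHermBlock R σ ε B) (hinf : infPt C ∈ B) {w w' : C × C} (hw : affPt σ ε w ∈ B)
    (hw' : affPt σ ε w' ∈ B) : w.1 = w'.1 := by
  obtain ⟨ℓ, ⟨f, hf, rfl⟩, -, rfl⟩ := hB
  obtain ⟨a, b, c, rfl⟩ := exists_eq_linForm f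
  have e₀ := (mk_rep_eq_zero_iff _ _).1 hinf.2
  have e₁ := (mk_rep_eq_zero_iff _ _).1 hw.2
  have e₂ := (mk_rep_eq_zero_iff _ _).1 hw'.2
  simp only [linForm_apply, Matrix.cons_val] at e₀ e₁ e₂
  have hb : b = 0 := by linear_combination e₀
  subst hb
  by_contra hne
  have hc : c = 0 := by
    have : c * (w.1 - w'.1) = 0 := by linear_combination e₁ - e₂
    exact (mul_eq_zero.1 this).resolve_right (sub_ne_zero.2 hne)
  subst hc
  have ha : a = 0 := by linear_combination e₁
  subst ha
  exact hf (LinearMap.ext fun v => by simp [linForm_apply])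

theorem QuadData.hasSubunitalTranslations_infPt (h : QuadData R σ ε t d) {q : ℕ} (hq : 2 ≤ q) :
    HasSubunitalTranslations R σ ε q (infPt C) := by
  rintro U hU hinf x₀ hx₀ x hx hx₀p hxp ⟨B, hB, hpB, hx₀B, hxB⟩
  obtain ⟨⟨z, r₀⟩, hr₀, rfl⟩ := (h.eq_infPt_or_affPt (hU.1 hx₀)).resolve_left hx₀p
  obtain ⟨⟨z', r₁⟩, hr₁, rfl⟩ := (h.eq_infPt_or_affPt (hU.1 hx)).resolve_left hxp
  obtain rfl : z = z' := fst_eq_of_mem_block hB hpB hx₀B hxB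
  have hs : r₁ - r₀ ∈ R := R.sub_mem hr₁ hr₀
  have hUfin : U.Finite := Set.finite_of_ncard_ne_zero (by rw [hU.2.1]; omega)
  refine ⟨_, h.isTranslation_elation hs, ?_, ?_⟩
  · simp only [elation_smul_affPt, add_sub_cancel]
  · refine Set.eq_of_subset_of_ncard_le ?_ ?_ hUfin
    · rintro _ ⟨P, hP, rfl⟩
      rcases h.eq_infPt_or_affPt (hU.1 hP) with rfl | ⟨⟨z', r⟩, hr, rfl⟩
      · simpa only [elation_smul_infPt] using hP
      · have := h.affPt_translate_mem hq hU hinf hr₀ hr₁ hx₀ hx hr hP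
        simp only [elation_smul_affPt]
        convert this using 3
        ring
    · rw [Set.ncard_image_of_injective _ (MulAction.injective _)]

theorem QuadData.hasSubunitalTranslations (h : QuadData R σ ε t d) {q : ℕ} (hq : 2 ≤ q)
    {p : ℙ C (Fin 3 → C)} (hp : p ∈ hermSet R σ ε) : HasSubunitalTranslations R σ ε q p := by
  rcases h.eq_infPt_or_affPt hp with rfl | ⟨⟨z, r⟩, hr, rfl⟩
  · exact h.hasSubunitalTranslations_infPt hq
  have hk : -ε / σ ε ≠ 0 :=
    div_ne_zero (neg_ne_zero.2 h.eps_ne_zero) ((map_ne_zero σ).2 h.eps_ne_zero)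
  have hz := h.norm_mem z
  obtain ⟨s, hs, e⟩ := h.preservesHerm_shear R.zero_mem (-z) ![1, ε * r - σ z * z, z] |>.2
    ⟨r, hr, by simp⟩
  simp only [shear_apply, Matrix.cons_val, map_one, map_add, map_mul, map_neg] at e
  refine h.hasSubunitalTranslations_of_smul (h.preservesHerm_shear R.zero_mem (-z)) ?_
  refine h.hasSubunitalTranslations_of_smul (h.preservesHerm_elation (R.neg_mem hs)) ?_
  refine h.hasSubunitalTranslations_of_smul (g := swap (-ε / σ ε) hk) (h.isHermVec_swap hk) ?_
  convert h.hasSubunitalTranslations_infPt hq using 1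
  rw [affPt, infPt, Projectivization.smul_mk, Projectivization.smul_mk, Projectivization.smul_mk]
  refine (Projectivization.mk_eq_mk_iff' C _ _ _ _).2 ⟨-ε / σ ε, ?_⟩
  ext i
  fin_cases i
  · simp [LinearEquiv.smul_def, swap_apply, shear_apply]
    linear_combination -e
  · simp [LinearEquiv.smul_def, swap_apply, shear_apply]
  · simp [LinearEquiv.smul_def, swap_apply, shear_apply]

end Subunitals

/-- If `U` is a subunital of order `q > 2` of `H(C|R)`, `p ∈ U`, and `x₀, x` are
distinct points of `U \ {p}` collinear with `p`, then some translation of `H(C|R)`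
with center `p` maps `x₀` to `x` and preserves `U`. -/
theorem translation_preserving_subunital
    {C : Type*} [Field C] (R : Subfield C) (ε t d : C) (σ : C →+* C)
    (hrank : Module.finrank R C = 2)
    (hε : ε ∉ R) (ht : t ∈ R) (hd : d ∈ R)
    (hmin : ε ^ 2 - t * ε + d = 0)
    (hσR : ∀ r ∈ R, σ r = r) (hσε : σ ε = t - ε)
    (q : ℕ) (hq : 2 < q)
    (U : Set (Projectivization C (Fin 3 → C))) (hU : IsSubunital R σ ε q U)
    (p x₀ x : Projectivization C (Fin 3 → C))
    (hp : p ∈ U) (hx₀ : x₀ ∈ U) (hx : x ∈ U)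
    (hx₀p : x₀ ≠ p) (hxp : x ≠ p) (hx₀x : x₀ ≠ x)
    (hcol : ∃ B, IsHermBlock R σ ε B ∧ p ∈ B ∧ x₀ ∈ B ∧ x ∈ B) :
    ∃ τ, IsTranslation (hermSet R σ ε) (IsHermBlock R σ ε) p τ ∧
      τ x₀ = x ∧ τ '' U = U := by
  have h : QuadData R σ ε t d := ⟨hrank, hε, ht, hd, hmin, hσR, hσε⟩
  exact h.hasSubunitalTranslations hq.le (hU.1 hp) U hU hp x₀ hx₀ x hx hx₀p hxp hcol
end
end

section
/- Let U be a subunital of order q of the generalized hermitian unital H(C|R) with q > 2, let p ∈ U, and let B be a block of the subunital not containing p (i.e. B = B̂ ∩ U for a block B̂ of H(C|R) with |B̂ ∩ U| = q + 1 and p ∉ B̂). Let B₀, …, B_q be the q + 1 blocks of the subunital through p that meet B. Then for every point x ∈ U with x ≠ p and x ∉ B lying on one of the blocks B₀, …, B_q, there exists a block of the subunital containing x that meets each of B₀, …, B_q in a point of U distinct from p. -/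
noncomputable section

/-- A block of the subunital `U`: the trace on `U` of a block of `H(C|R)` meeting
`U` in at least two points. -/
def IsSubBlock {C : Type*} [Field C] (R : Subfield C) (σ : C →+* C) (ε : C)
    (U b : Set (Projectivization C (Fin 3 → C))) : Prop :=
  ∃ D, IsHermBlock R σ ε D ∧ (D ∩ U).Nontrivial ∧ b = D ∩ U

section Conjugation

variable {C : Type*} [Field C] {R : Subfield C} {σ : C →+* C} {ε : C}

/-- The `R`-line `εR` in `C`. -/
abbrev epsLine (R : Subfield C) (ε : C) : Submodule R C := Submodule.span R {ε}

theorem mem_epsLine {w : C} : w ∈ epsLine R ε ↔ ∃ r ∈ R, w = ε * r := by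
  rw [Submodule.mem_span_singleton]
  constructor
  · rintro ⟨r, rfl⟩
    exact ⟨r, r.2, by rw [Subfield.smul_def, smul_eq_mul, mul_comm]⟩
  · rintro ⟨r, hr, rfl⟩
    exact ⟨⟨r, hr⟩, by rw [Subfield.smul_def, smul_eq_mul, mul_comm]⟩

theorem mul_mem_epsLine {r w : C} (hr : r ∈ R) (hw : w ∈ epsLine R ε) :
    r * w ∈ epsLine R ε :=
  (epsLine R ε).smul_mem ⟨r, hr⟩ hw

theorem eq_zero_of_mem_of_mem_epsLine (hε : ε ∉ R) {w : C} (hw : w ∈ R)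
    (hw' : w ∈ epsLine R ε) : w = 0 := by
  obtain ⟨r, hr, rfl⟩ := mem_epsLine.1 hw'
  by_contra h
  have hr0 : r ≠ 0 := right_ne_zero_of_mul h
  exact hε (by simpa [hr0] using R.div_mem hw hr)

theorem exists_eq_add_mul_of_finrank_eq_two (hrank : Module.finrank R C = 2) (hε : ε ∉ R)
    (w : C) : ∃ u ∈ R, ∃ v ∈ R, w = u + v * ε := by
  have hli : LinearIndependent R ![(1 : C), ε] := by
    rw [LinearIndependent.pair_iff]
    intro s r h
    simp only [Subfield.smul_def, smul_eq_mul, mul_one] at h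
    have hr : (r : C) = 0 := by
      by_contra hr
      have : ε = -(s : C) / r := by field_simp; linear_combination h
      exact hε (this ▸ R.div_mem (R.neg_mem s.2) r.2)
    rw [hr] at h
    exact ⟨Subtype.ext (by simpa using h), Subtype.ext hr⟩
  have htop := hli.span_eq_top_of_card_eq_finrank (by simp [hrank])
  have hw : w ∈ Submodule.span R (Set.range ![(1 : C), ε]) := htop ▸ Submodule.mem_top
  rw [Matrix.range_cons, Matrix.range_cons, Matrix.range_empty, Set.union_empty,
    Set.singleton_union, Submodule.mem_span_pair] at hw
  obtain ⟨u, v, rfl⟩ := hw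
  exact ⟨u, u.2, v, v.2, by simp [Subfield.smul_def]⟩

/-- The facts about `σ` used in the geometry of `H(C|R)`: norms lie in `R`, and `σ` agrees
modulo `εR` with multiplication by the unit-norm element `k`. -/
structure IsUnitalConj (R : Subfield C) (σ : C →+* C) (ε k : C) : Prop where
  not_mem : ε ∉ R
  involutive : ∀ w, σ (σ w) = w
  norm_mem : ∀ w, σ w * w ∈ R
  fix : ∀ r ∈ R, σ r = r
  conj_sub_mem : ∀ w, σ w - k * w ∈ epsLine R ε
  norm_k : σ k * k = 1

theorem exists_isUnitalConj {t d : C} (hrank : Module.finrank R C = 2)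
    (hε : ε ∉ R) (ht : t ∈ R) (hd : d ∈ R) (hmin : ε ^ 2 - t * ε + d = 0)
    (hσR : ∀ r ∈ R, σ r = r) (hσε : σ ε = t - ε) : ∃ k, IsUnitalConj R σ ε k := by
  have hdec := exists_eq_add_mul_of_finrank_eq_two hrank hε
  have hinv : ∀ w, σ (σ w) = w := by
    intro w
    obtain ⟨u, hu, v, hv, rfl⟩ := hdec w
    simp only [map_add, map_mul, map_sub, hσR u hu, hσR v hv, hσε, hσR t ht]
    ring
  have hε0 : ε ≠ 0 := fun h => hε (h ▸ R.zero_mem)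
  have hσε0 : σ ε ≠ 0 := by simpa using hε0
  have hd0 : d = ε * σ ε := by rw [hσε]; linear_combination hmin
  refine ⟨-ε / σ ε, hε, hinv, ?_, hσR, ?_, ?_⟩
  · intro w
    obtain ⟨u, hu, v, hv, rfl⟩ := hdec w
    have : σ (u + v * ε) * (u + v * ε) = u * u + u * v * t + v * v * d := by
      simp only [map_add, map_mul, hσR u hu, hσR v hv, hσε]
      linear_combination (-v ^ 2) * hmin
    rw [this]
    exact R.add_mem (R.add_mem (R.mul_mem hu hu) (R.mul_mem (R.mul_mem hu hv) ht))
      (R.mul_mem (R.mul_mem hv hv) hd)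
  · intro w
    obtain ⟨u, hu, v, hv, rfl⟩ := hdec w
    refine mem_epsLine.2 ⟨(u * t + v * (t * t - (d + d))) / d, R.div_mem (R.add_mem
      (R.mul_mem hu ht) (R.mul_mem hv (R.sub_mem (R.mul_mem ht ht) (R.add_mem hd hd)))) hd, ?_⟩
    have ht' : t = σ ε + ε := by rw [hσε]; ring
    simp only [map_add, map_mul, hσR u hu, hσR v hv]
    rw [hd0, ht']
    field_simp
    ring
  · rw [map_div₀, map_neg, hinv]
    field_simp

/-- The form `σ(X)·Y + σ(Z)·Z` defining `H(C|R)`. -/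
def hermForm (σ : C →+* C) (v : Fin 3 → C) : C := σ (v 0) * v 1 + σ (v 2) * v 2

theorem hermForm_smul (a : C) (v : Fin 3 → C) :
    hermForm σ (a • v) = σ a * a * hermForm σ v := by
  simp only [hermForm, Pi.smul_apply, smul_eq_mul, map_mul]
  ring

namespace IsUnitalConj

variable {k : C}

theorem eq_zero_of_norm_mem (h : IsUnitalConj R σ ε k) {w : C}
    (hw : σ w * w ∈ epsLine R ε) : w = 0 := by
  simpa using eq_zero_of_mem_of_mem_epsLine h.not_mem (h.norm_mem w) hw

theorem hermForm_rep_mem (h : IsUnitalConj R σ ε k) {P : Projectivization C (Fin 3 → C)}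
    (hP : P ∈ hermSet R σ ε) : hermForm σ P.rep ∈ epsLine R ε := by
  obtain ⟨v, hv, rfl, hr⟩ := hP
  obtain ⟨a, ha⟩ := Projectivization.exists_smul_eq_mk_rep C v hv
  rw [← ha, Units.smul_def, hermForm_smul]
  exact mul_mem_epsLine (h.norm_mem _) (mem_epsLine.2 hr)

/-- `H(C|R)` is point-transitive: each of its points is moved to `[0,1,0]` by a collineation
preserving `H(C|R)`. -/
theorem exists_equiv (h : IsUnitalConj R σ ε k) {v : Fin 3 → C}
    (hv : hermForm σ v ∈ epsLine R ε) :
    ∃ f : (Fin 3 → C) ≃ₗ[C] (Fin 3 → C), f v 0 = 0 ∧ f v 2 = 0 ∧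
      ∀ w, hermForm σ w ∈ epsLine R ε → hermForm σ (f w) ∈ epsLine R ε := by
  by_cases h0 : v 0 = 0
  · refine ⟨LinearEquiv.refl C _, h0, ?_, fun w hw => hw⟩
    simp only [hermForm, h0, map_zero, zero_mul, zero_add] at hv
    exact h.eq_zero_of_norm_mem hv
  have hk : k ≠ 0 := right_ne_zero_of_mul (h.norm_k ▸ one_ne_zero)
  obtain ⟨c, hc⟩ : ∃ c, v 2 = c * v 0 := ⟨v 2 / v 0, by field_simp⟩
  obtain ⟨e, he⟩ : ∃ e, v 1 = e * v 0 := ⟨v 1 / v 0, by field_simp⟩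
  have hec : e + σ c * c ∈ epsLine R ε := by
    have hv' : hermForm σ v = (σ (v 0) * v 0) * (e + σ c * c) := by
      simp only [hermForm, hc, he, map_mul]
      ring
    have h0' : σ (v 0) * v 0 ≠ 0 := by simpa using h0
    have := mul_mem_epsLine (R.inv_mem (h.norm_mem (v 0))) (hv' ▸ hv)
    rwa [inv_mul_cancel_left₀ h0'] at this
  set A := (1 + k) * σ c with hA
  set B := -e - (1 + k) * (σ c * c) with hB
  let f : (Fin 3 → C) ≃ₗ[C] (Fin 3 → C) :=
    { toFun := fun w => ![w 1 + A * w 2 + B * w 0, k * w 0, w 2 - c * w 0]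
      invFun := fun u => ![u 1 / k, u 0 - A * (u 2 + c * (u 1 / k)) - B * (u 1 / k),
        u 2 + c * (u 1 / k)]
      map_add' := fun u w => by
        ext i; fin_cases i <;> simp <;> ring
      map_smul' := fun a w => by
        ext i; fin_cases i <;> simp <;> ring
      left_inv := fun w => by
        ext i; fin_cases i <;> simp <;> field_simp <;> ring
      right_inv := fun w => by
        ext i; fin_cases i <;> simp <;> field_simp
        ring }
  have hf0 : ∀ w, f w 0 = w 1 + A * w 2 + B * w 0 := fun w => rfl
  have hf1 : ∀ w, f w 1 = k * w 0 := fun w => rfl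
  have hf2 : ∀ w, f w 2 = w 2 - c * w 0 := fun w => rfl
  refine ⟨f, ?_, ?_, ?_⟩
  · rw [hf0, he, hc, hA, hB]; ring
  · rw [hf2, hc]; ring
  intro w hw
  have h1 := h.conj_sub_mem (σ k * (w 1 + A * w 2 + B * w 0) * σ (w 0))
  have h2 := h.conj_sub_mem (σ c * σ (w 0) * w 2)
  have h3 := mul_mem_epsLine (h.norm_mem (w 0)) hec
  have h4 := mul_mem_epsLine (h.norm_mem (w 0)) (h.conj_sub_mem (σ c * c))
  have hsum := add_mem (sub_mem (add_mem (sub_mem hw h2) h4) h3) h1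
  simp only [map_mul, h.involutive] at hsum
  convert hsum using 1
  simp only [hermForm, hf0, hf1, hf2, map_sub, map_mul]
  rw [hA, hB]
  linear_combination ((w 1 + (1 + k) * σ c * w 2 + (-e - (1 + k) * (σ c * c)) * w 0) * σ (w 0))
    * h.norm_k

end IsUnitalConj

/-- Affine coordinates `(z, y)` on the points of `H(C|R)` other than `p`, in which the
lines through `p` are those with `z` constant, and the other lines are the graphs
`y = a + b z`. -/
structure IsUnitalChart (R : Subfield C) (σ : C →+* C) (ε : C)
    (p : Projectivization C (Fin 3 → C)) (z y : Projectivization C (Fin 3 → C) → C) : Prop where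
  mem : ∀ P ∈ hermSet R σ ε, P ≠ p → y P + σ (z P) * z P ∈ epsLine R ε
  inj : ∀ P ∈ hermSet R σ ε, ∀ Q ∈ hermSet R σ ε, P ≠ p → Q ≠ p → z P = z Q → y P = y Q → P = Q
  exists_graph : ∀ ℓ, IsLine C ℓ → p ∉ ℓ → ∃ a b, ∀ P ∈ hermSet R σ ε, P ≠ p →
    (P ∈ ℓ ↔ y P = a + b * z P)
  exists_line : ∀ a b, ∃ ℓ, IsLine C ℓ ∧ p ∉ ℓ ∧ ∀ P ∈ hermSet R σ ε, P ≠ p →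
    (P ∈ ℓ ↔ y P = a + b * z P)
  mem_iff : ∀ ℓ, IsLine C ℓ → p ∈ ℓ → ∀ Q ∈ hermSet R σ ε, Q ≠ p → Q ∈ ℓ →
    ∀ P ∈ hermSet R σ ε, P ≠ p → (P ∈ ℓ ↔ z P = z Q)
  exists_vertical : ∀ c, ∃ ℓ, IsLine C ℓ ∧ p ∈ ℓ ∧ ∀ P ∈ hermSet R σ ε, P ≠ p →
    (P ∈ ℓ ↔ z P = c)

theorem eq_of_rep_eq_smul {V : Type*} [AddCommGroup V] [Module C V] {P Q : Projectivization C V}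
    {a : C} (h : P.rep = a • Q.rep) : P = Q := by
  rw [← P.mk_rep, ← Q.mk_rep, Projectivization.mk_eq_mk_iff']
  exact ⟨a, h.symm⟩

theorem isLine_of_coeffs (f : (Fin 3 → C) ≃ₗ[C] (Fin 3 → C)) {α β γ : C}
    (hne : ¬(α = 0 ∧ β = 0 ∧ γ = 0)) :
    IsLine C {P | α * f P.rep 0 + β * f P.rep 1 + γ * f P.rep 2 = 0} := by
  let φ : (Fin 3 → C) →ₗ[C] C :=
    α • LinearMap.proj 0 + β • LinearMap.proj 1 + γ • LinearMap.proj 2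
  refine ⟨φ ∘ₗ f.toLinearMap, ?_, rfl⟩
  intro h0
  have hφ : ∀ v, φ v = 0 := fun v => by
    simpa using LinearMap.congr_fun h0 (f.symm v)
  exact hne ⟨by simpa [φ] using hφ (Pi.single 0 1), by simpa [φ] using hφ (Pi.single 1 1),
    by simpa [φ] using hφ (Pi.single 2 1)⟩

theorem IsLine.exists_coeffs {ℓ : Set (Projectivization C (Fin 3 → C))} (hℓ : IsLine C ℓ)
    (f : (Fin 3 → C) ≃ₗ[C] (Fin 3 → C)) :
    ∃ α β γ : C, ¬(α = 0 ∧ β = 0 ∧ γ = 0) ∧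
      ∀ P, P ∈ ℓ ↔ α * f P.rep 0 + β * f P.rep 1 + γ * f P.rep 2 = 0 := by
  obtain ⟨φ, hφ, rfl⟩ := hℓ
  let ψ := φ ∘ₗ f.symm.toLinearMap
  have hψ : ∀ v, ψ v = ψ (Pi.single 0 1) * v 0 + ψ (Pi.single 1 1) * v 1
      + ψ (Pi.single 2 1) * v 2 := fun v => by
    conv_lhs => rw [pi_eq_sum_univ' v, map_sum]
    simp only [Fin.sum_univ_three, map_smul, smul_eq_mul, mul_comm]
  have hψf : ∀ v, φ v = ψ (f v) := fun v => by simp [ψ]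
  refine ⟨_, _, _, ?_, fun P => by rw [← hψ, ← hψf]; rfl⟩
  rintro ⟨h0, h1, h2⟩
  exact hφ (LinearMap.ext fun v => by rw [hψf, hψ, h0, h1, h2]; simp)

theorem IsUnitalConj.exists_isUnitalChart {k : C} (h : IsUnitalConj R σ ε k)
    {p : Projectivization C (Fin 3 → C)} (hp : p ∈ hermSet R σ ε) :
    ∃ z y, IsUnitalChart R σ ε p z y := by
  obtain ⟨f, hp0, hp2, hf⟩ := h.exists_equiv (h.hermForm_rep_mem hp)
  have hp1 : f p.rep 1 ≠ 0 := fun hp1 => p.rep_nonzero <| f.map_eq_zero_iff.1 <| by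
    ext i; fin_cases i <;> simp [hp0, hp1, hp2]
  have hX : ∀ P ∈ hermSet R σ ε, P ≠ p → f P.rep 0 ≠ 0 := by
    intro P hP hPp h0
    have h2 := hf _ (h.hermForm_rep_mem hP)
    simp only [hermForm, h0, map_zero, zero_mul, zero_add] at h2
    have h2 := h.eq_zero_of_norm_mem h2
    refine hPp (eq_of_rep_eq_smul (a := f P.rep 1 / f p.rep 1) (f.injective ?_))
    rw [map_smul]
    ext i; fin_cases i <;> simp [h0, h2, hp0, hp2, hp1]
  refine ⟨fun P => f P.rep 2 / f P.rep 0, fun P => f P.rep 1 / f P.rep 0, ?_, ?_, ?_, ?_, ?_, ?_⟩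
  · intro P hP hPp
    have h0 := hX P hP hPp
    have h1 := mul_mem_epsLine (h.norm_mem (f P.rep 0)⁻¹) (hf _ (h.hermForm_rep_mem hP))
    rw [← hermForm_smul] at h1
    simpa [hermForm, h0, div_eq_inv_mul] using h1
  · intro P hP Q hQ hPp hQp hz hy
    have h0 := hX P hP hPp
    have h0' := hX Q hQ hQp
    refine eq_of_rep_eq_smul (a := f P.rep 0 / f Q.rep 0) (f.injective ?_)
    rw [map_smul]
    rw [div_eq_div_iff h0 h0'] at hz hy
    ext i; fin_cases i
    · simp [h0']
    · simp only [Fin.mk_one, Pi.smul_apply, smul_eq_mul]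
      field_simp
      linear_combination hy
    · simp only [Fin.reduceFinMk, Pi.smul_apply, smul_eq_mul]
      field_simp
      linear_combination hz
  · intro ℓ hℓ hpℓ
    obtain ⟨α, β, γ, -, hmem⟩ := hℓ.exists_coeffs f
    have hβ : β ≠ 0 := fun hβ => hpℓ <| by rw [hmem, hp0, hp2, hβ]; ring
    refine ⟨-α / β, -γ / β, fun P hP hPp => ?_⟩
    have h0 := hX P hP hPp
    rw [hmem]
    field_simp
    exact ⟨fun e => by linear_combination e, fun e => by linear_combination e⟩
  · intro a b
    refine ⟨_, isLine_of_coeffs f (α := -a) (β := 1) (γ := -b) (by simp), ?_, ?_⟩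
    · simp [hp0, hp2, hp1]
    · intro P hP hPp
      have h0 := hX P hP hPp
      rw [Set.mem_ofPred_eq]
      field_simp
      exact ⟨fun e => by linear_combination e, fun e => by linear_combination e⟩
  · intro ℓ hℓ hpℓ Q hQ hQp hQℓ P hP hPp
    obtain ⟨α, β, γ, hne, hmem⟩ := hℓ.exists_coeffs f
    have hβ : β = 0 := by
      rw [hmem, hp0, hp2] at hpℓ
      simpa [hp1] using hpℓ
    have h0 := hX P hP hPp
    have h0' := hX Q hQ hQp
    rw [hmem, hβ] at hQℓ ⊢
    have hγ : γ ≠ 0 := fun hγ => hne ⟨by simpa [hγ, h0'] using hQℓ, hβ, hγ⟩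
    rw [div_eq_div_iff h0 h0']
    constructor
    · intro e
      apply mul_left_cancel₀ hγ
      linear_combination f Q.rep 0 * e - f P.rep 0 * hQℓ
    · intro e
      apply mul_left_cancel₀ h0'
      linear_combination γ * e + f P.rep 0 * hQℓ
  · intro c
    refine ⟨_, isLine_of_coeffs f (α := -c) (β := 0) (γ := 1) (by simp), ?_, ?_⟩
    · simp [hp0, hp2]
    · intro P hP hPp
      have h0 := hX P hP hPp
      rw [Set.mem_ofPred_eq]
      field_simp
      exact ⟨fun e => by linear_combination e, fun e => by linear_combination e⟩

/-- A line through three points with distinct first coordinates on the affine unital is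
determined, up to a translation, by these first coordinates. -/
theorem IsUnitalConj.slope_unique {k : C} (h : IsUnitalConj R σ ε k) {z₀ z₁ z₂ a b a' b' : C}
    (h01 : z₀ ≠ z₁) (h02 : z₀ ≠ z₂) (h12 : z₁ ≠ z₂)
    (h0 : a + b * z₀ + σ z₀ * z₀ ∈ epsLine R ε) (h1 : a + b * z₁ + σ z₁ * z₁ ∈ epsLine R ε)
    (h2 : a + b * z₂ + σ z₂ * z₂ ∈ epsLine R ε)
    (h0' : a' + b' * z₀ + σ z₀ * z₀ ∈ epsLine R ε) (h1' : a' + b' * z₁ + σ z₁ * z₁ ∈ epsLine R ε)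
    (h2' : a' + b' * z₂ + σ z₂ * z₂ ∈ epsLine R ε) : b = b' := by
  by_contra hb
  have hβ : b - b' ≠ 0 := sub_ne_zero.2 hb
  obtain ⟨r, hr, e1⟩ := mem_epsLine.1 (sub_mem (sub_mem h1 h1') (sub_mem h0 h0'))
  obtain ⟨s, hs, e2⟩ := mem_epsLine.1 (sub_mem (sub_mem h2 h2') (sub_mem h0 h0'))
  replace e1 : (b - b') * (z₁ - z₀) = ε * r := by linear_combination e1
  replace e2 : (b - b') * (z₂ - z₀) = ε * s := by linear_combination e2
  have hr0 : r ≠ 0 := by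
    rintro rfl
    rw [mul_zero, mul_eq_zero, sub_eq_zero, sub_eq_zero] at e1
    exact e1.elim hb fun e => h01 e.symm
  obtain ⟨l, hl, hz2⟩ : ∃ l ∈ R, z₂ = z₀ + l * (z₁ - z₀) := by
    refine ⟨s / r, R.div_mem hs hr, ?_⟩
    have hε0 : ε ≠ 0 := fun e => h.not_mem (e ▸ R.zero_mem)
    have : s * (z₁ - z₀) = r * (z₂ - z₀) := by
      apply mul_left_cancel₀ (mul_ne_zero hβ hε0)
      linear_combination ε * s * e1 - ε * r * e2
    field_simp
    linear_combination -this
  have hl0 : l ≠ 0 := by rintro rfl; exact h02 (by rw [hz2]; ring)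
  have hl1 : l - 1 ≠ 0 := fun e => h12 (by rw [hz2]; linear_combination (z₀ - z₁) * e)
  have hmem := sub_mem (sub_mem h2 h0) (mul_mem_epsLine hl (sub_mem h1 h0))
  have hN : l * (l - 1) * (σ (z₁ - z₀) * (z₁ - z₀)) ∈ epsLine R ε := by
    convert hmem using 1
    rw [hz2]
    simp only [map_add, map_mul, map_sub, h.fix l hl]
    ring
  have hzero := eq_zero_of_mem_of_mem_epsLine h.not_mem
    (R.mul_mem (R.mul_mem hl (R.sub_mem hl R.one_mem)) (h.norm_mem _)) hN
  simp only [mul_eq_zero, map_eq_zero, or_self, hl0, hl1, sub_eq_zero, false_or] at hzero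
  exact h01 hzero.symm

/-- In a finite set `V` of affine points of the unital all of whose nonempty vertical fibres
have `q` points and all of whose connecting lines have `q + 1` points, any two vertical
fibres are translates of each other, in all ways relating some pair of their points. -/
theorem IsUnitalConj.translate_mem {k : C} (h : IsUnitalConj R σ ε k) {q : ℕ} (hq : 2 ≤ q)
    (V : Finset (C × C)) (hcard : V.card = q ^ 3)
    (hV : ∀ v ∈ V, v.2 + σ v.1 * v.1 ∈ epsLine R ε)
    (hfib : ∀ v ∈ V, {u : C × C | u ∈ V ∧ u.1 = v.1}.ncard = q)
    (hline : ∀ a b : C, (∃ v ∈ V, ∃ w ∈ V, v.1 ≠ w.1 ∧ v.2 = a + b * v.1 ∧ w.2 = a + b * w.1) →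
      {u : C × C | u ∈ V ∧ u.2 = a + b * u.1}.ncard = q + 1)
    {z₀ y₀ z₁ y₁ s : C} (h0 : (z₀, y₀) ∈ V) (h1 : (z₁, y₁) ∈ V) (h01 : z₀ ≠ z₁)
    (hs : (z₀, y₀ + s) ∈ V) : (z₁, y₁ + s) ∈ V := by
  classical
  have hfib' : ∀ v ∈ V, (V.filter fun u => u.1 = v.1).card = q := fun v hv => by
    rw [← hfib v hv, ← Set.ncard_coe_finset]; simp
  have hline' : ∀ a b : C,
      (∃ v ∈ V, ∃ w ∈ V, v.1 ≠ w.1 ∧ v.2 = a + b * v.1 ∧ w.2 = a + b * w.1) →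
      (V.filter fun u => u.2 = a + b * u.1).card = q + 1 := fun a b hab => by
    rw [← hline a b hab, ← Set.ncard_coe_finset]; simp
  set P := V.image Prod.fst with hP
  have hPcard : P.card = q ^ 2 := by
    have := Finset.card_eq_sum_card_image Prod.fst V
    rw [Finset.sum_const_nat (m := q), hcard] at this
    · exact Nat.eq_of_mul_eq_mul_right (by omega : 0 < q) (by rw [← this]; ring)
    · intro z hz
      obtain ⟨v, hv, rfl⟩ := Finset.mem_image.1 hz
      exact hfib' v hv
  set F₀ := V.filter fun u => u.1 = z₀ with hF₀
  set F₁ := V.filter fun u => u.1 = z₁ with hF₁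
  have hc₀ : F₀.card = q := hfib' _ h0
  have hc₁ : F₁.card = q := hfib' _ h1
  set D := (F₀ ×ˢ F₁).image fun e => e.2.2 - e.1.2 with hD
  -- the first coordinates of the remaining points on a line of slope `δ / (z₁ - z₀)`
  have hz : z₁ - z₀ ≠ 0 := sub_ne_zero.2 h01.symm
  have hT : ∀ δ ∈ D, ∃ T : Finset C, T.card = q - 1 ∧ T ⊆ (P.erase z₀).erase z₁ ∧
      ∃ a b, δ = b * (z₁ - z₀) ∧ ∀ z ∈ insert z₀ (insert z₁ T), (z, a + b * z) ∈ V := by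
    intro δ hδ
    obtain ⟨⟨⟨u, e⟩, ⟨w, f⟩⟩, huw, rfl⟩ := Finset.mem_image.1 hδ
    simp only [hF₀, hF₁, Finset.mem_product, Finset.mem_filter] at huw
    obtain ⟨⟨hu, rfl⟩, hw, rfl⟩ := huw
    set b := (f - e) / (w - u) with hb
    have hbδ : f - e = b * (w - u) := by rw [hb]; field_simp
    have hL := hline' (e - b * u) b ⟨_, hu, _, hw, h01, by ring, by linear_combination hbδ⟩
    set L := V.filter fun v => v.2 = e - b * u + b * v.1 with hLdef
    have hLinj : Set.InjOn Prod.fst (L : Set (C × C)) := by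
      rintro ⟨z, y⟩ h1 ⟨z', y'⟩ h2 rfl
      simp only [hLdef, Finset.coe_filter, Set.mem_ofPred_eq] at h1 h2
      rw [Prod.mk.injEq, h1.2, h2.2]
      exact ⟨rfl, rfl⟩
    have hmem : ∀ z ∈ L.image Prod.fst, (z, e - b * u + b * z) ∈ V := by
      intro z hz
      obtain ⟨⟨z, y⟩, hv, rfl⟩ := Finset.mem_image.1 hz
      obtain ⟨hv, hy⟩ := Finset.mem_filter.1 hv
      simpa only [← hy] using hv
    have huL : u ∈ L.image Prod.fst :=
      Finset.mem_image.2 ⟨(u, e), Finset.mem_filter.2 ⟨hu, by ring⟩, rfl⟩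
    have hwL : w ∈ L.image Prod.fst :=
      Finset.mem_image.2 ⟨(w, f), Finset.mem_filter.2 ⟨hw, by linear_combination hbδ⟩, rfl⟩
    refine ⟨((L.image Prod.fst).erase u).erase w, ?_, ?_, e - b * u, b, hbδ, ?_⟩
    · rw [Finset.card_erase_of_mem (Finset.mem_erase.2 ⟨h01.symm, hwL⟩),
        Finset.card_erase_of_mem huL, Finset.card_image_of_injOn hLinj, hL]
      rfl
    · exact Finset.erase_subset_erase _ (Finset.erase_subset_erase _
        (Finset.image_subset_image (Finset.filter_subset _ _)))
    · intro z hz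
      apply hmem
      simp only [Finset.mem_insert, Finset.mem_erase] at hz
      rcases hz with rfl | rfl | hz
      exacts [huL, hwL, hz.2.2]
  have hDcard : D.card ≤ q := by
    choose! T hTc hTP a b hδ hTV using hT
    have hdisj : ∀ δ ∈ D, ∀ δ' ∈ D, δ ≠ δ' → Disjoint (T δ) (T δ') := by
      intro δ hD δ' hD' hne
      rw [Finset.disjoint_left]
      intro z hz hz'
      have hz0 := hTP δ hD hz
      simp only [Finset.mem_erase] at hz0
      have hV1 := fun z hz => hV _ (hTV δ hD z hz)
      have hV2 := fun z hz => hV _ (hTV δ' hD' z hz)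
      apply hne
      rw [hδ δ hD, hδ δ' hD', h.slope_unique h01 (Ne.symm hz0.2.1) (Ne.symm hz0.1)
        (hV1 z₀ (by simp)) (hV1 z₁ (by simp)) (hV1 z (by simp [hz]))
        (hV2 z₀ (by simp)) (hV2 z₁ (by simp)) (hV2 z (by simp [hz']))]
    have hle := Finset.card_le_card (Finset.biUnion_subset.2 hTP)
    rw [Finset.card_biUnion hdisj, Finset.sum_const_nat hTc,
      Finset.card_erase_of_mem (Finset.mem_erase.2 ⟨h01.symm, Finset.mem_image_of_mem _ h1⟩),
      Finset.card_erase_of_mem (Finset.mem_image_of_mem Prod.fst h0), hPcard] at hle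
    by_contra! hlt
    have := Nat.mul_le_mul_right (q - 1) hlt
    obtain ⟨m, rfl⟩ : ∃ m, q = m + 2 := ⟨q - 2, by omega⟩
    have e1 : m + 2 - 1 = m + 1 := by omega
    have e2 : (m + 2) ^ 2 - 1 - 1 = m ^ 2 + 4 * m + 2 := by
      rw [show (m + 2) ^ 2 = m ^ 2 + 4 * m + 4 by ring]; omega
    rw [e1] at this hle
    rw [e2] at hle
    simp only [Nat.succ_eq_add_one] at this
    nlinarith
  -- each difference is attained from every point of the fibre over `z₀`
  set M := fun δ : C => F₀.filter fun u => (z₁, u.2 + δ) ∈ V with hM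
  have hMle : ∀ δ ∈ D, (M δ).card ≤ q := fun δ _ => hc₀ ▸ Finset.card_filter_le _ _
  have hsum : ∑ δ ∈ D, (M δ).card = q * q := by
    have hprod : (F₀ ×ˢ F₁).card = q * q := by rw [Finset.card_product, hc₀, hc₁]
    rw [← hprod, Finset.card_eq_sum_card_image fun e => e.2.2 - e.1.2]
    refine Finset.sum_congr rfl fun δ _ =>
      Finset.card_nbij' (fun u => (u, (z₁, u.2 + δ))) Prod.fst ?_ ?_ ?_ ?_
    · intro u hu
      simp_all [Finset.mem_filter]
    · rintro ⟨u, w, f⟩ huw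
      simp only [hM, hF₀, hF₁, Finset.coe_filter, Finset.mem_product, Finset.mem_filter,
        Set.mem_ofPred_eq] at huw ⊢
      obtain ⟨⟨hu, hw, rfl⟩, rfl⟩ := huw
      exact ⟨hu, by simpa using hw⟩
    · intro u _
      rfl
    · rintro ⟨u, w, f⟩ huw
      simp only [hF₀, hF₁, Finset.coe_filter, Finset.mem_product, Finset.mem_filter,
        Set.mem_ofPred_eq] at huw ⊢
      obtain ⟨⟨-, -, rfl⟩, rfl⟩ := huw
      simp
  have hMδ : M (y₁ - y₀) = F₀ := by
    by_contra hne
    have hδ : y₁ - y₀ ∈ D :=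
      Finset.mem_image.2 ⟨((z₀, y₀), (z₁, y₁)), by simp [hF₀, hF₁, h0, h1], rfl⟩
    have hlt : (M (y₁ - y₀)).card < q :=
      hc₀ ▸ Finset.card_lt_card (Finset.ssubset_iff_subset_ne.2 ⟨Finset.filter_subset _ _, hne⟩)
    have := Finset.sum_lt_sum hMle ⟨_, hδ, hlt⟩
    rw [hsum, Finset.sum_const, smul_eq_mul] at this
    exact absurd this (not_lt.2 (Nat.mul_le_mul_right q hDcard))
  have hmem : (z₀, y₀ + s) ∈ M (y₁ - y₀) := hMδ ▸ Finset.mem_filter.2 ⟨hs, rfl⟩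
  have := (Finset.mem_filter.1 hmem).2
  convert this using 2
  ring

/-- Two points of a subunital `U` on a common line through `p ∈ U` differ by a translation
with centre `p`, which maps all of `U` outside that line to `U`. -/
theorem IsUnitalConj.translate_subunital {k : C} (h : IsUnitalConj R σ ε k) {q : ℕ} (hq : 2 ≤ q)
    {U : Set (Projectivization C (Fin 3 → C))} (hU : IsSubunital R σ ε q U)
    {p : Projectivization C (Fin 3 → C)} (hp : p ∈ U)
    {z y : Projectivization C (Fin 3 → C) → C} (hc : IsUnitalChart R σ ε p z y) :
    ∀ w ∈ U, w ≠ p → ∀ v ∈ U, v ≠ p → z w ≠ z v → ∀ x ∈ U, x ≠ p → z x = z w →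
      ∃ u ∈ U, u ≠ p ∧ z u = z v ∧ y u = y v + (y x - y w) := by
  obtain ⟨hUH, hUcard, hUblock⟩ := hU
  have hfin : U.Finite := Set.finite_of_ncard_pos (by omega)
  set g : Projectivization C (Fin 3 → C) → C × C := fun P => (z P, y P) with hg
  have hinj : Set.InjOn g (U \ {p}) := fun P hP Q hQ e =>
    hc.inj P (hUH hP.1) Q (hUH hQ.1) hP.2 hQ.2 (congrArg Prod.fst e) (congrArg Prod.snd e)
  have hVfin : (g '' (U \ {p})).Finite := hfin.sdiff.image g
  have hmem : ∀ v, v ∈ hVfin.toFinset ↔ ∃ P, (P ∈ U ∧ P ≠ p) ∧ g P = v := fun v => by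
    simp [Set.mem_image]
  have key : ∀ {z₀ y₀ z₁ y₁ s : C}, (z₀, y₀) ∈ hVfin.toFinset → (z₁, y₁) ∈ hVfin.toFinset →
      z₀ ≠ z₁ → (z₀, y₀ + s) ∈ hVfin.toFinset → (z₁, y₁ + s) ∈ hVfin.toFinset := by
    refine h.translate_mem hq hVfin.toFinset ?_ ?_ ?_ ?_
    · rw [← Set.ncard_eq_toFinset_card _ hVfin, hinj.ncard_image,
        Set.ncard_sdiff_singleton_of_mem hp, hUcard, Nat.add_sub_cancel]
    · intro v hv
      obtain ⟨P, ⟨hP, hPp⟩, rfl⟩ := (hmem v).1 hv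
      exact hc.mem P (hUH hP) hPp
    · intro v hv
      obtain ⟨P, ⟨hP, hPp⟩, rfl⟩ := (hmem v).1 hv
      obtain ⟨ℓ, hℓ, hpℓ, hvert⟩ := hc.exists_vertical (z P)
      have hPD : P ∈ (hermSet R σ ε ∩ ℓ) ∩ U := ⟨⟨hUH hP, (hvert P (hUH hP) hPp).2 rfl⟩, hP⟩
      have hpD : p ∈ (hermSet R σ ε ∩ ℓ) ∩ U := ⟨⟨hUH hp, hpℓ⟩, hp⟩
      have hnt : ((hermSet R σ ε ∩ ℓ) ∩ U).Nontrivial := ⟨P, hPD, p, hpD, hPp⟩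
      have hcard := hUblock _ ⟨ℓ, hℓ, hnt.mono Set.inter_subset_left, rfl⟩ hnt
      have himg : {u : C × C | u ∈ hVfin.toFinset ∧ u.1 = (g P).1} =
          g '' (((hermSet R σ ε ∩ ℓ) ∩ U) \ {p}) := by
        ext u
        constructor
        · rintro ⟨hu, hu1⟩
          obtain ⟨Q, ⟨hQ, hQp⟩, rfl⟩ := (hmem u).1 hu
          exact ⟨Q, ⟨⟨⟨hUH hQ, (hvert Q (hUH hQ) hQp).2 hu1⟩, hQ⟩, hQp⟩, rfl⟩
        · rintro ⟨Q, ⟨⟨⟨hQH, hQℓ⟩, hQ⟩, hQp⟩, rfl⟩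
          exact ⟨(hmem _).2 ⟨Q, ⟨hQ, hQp⟩, rfl⟩, (hvert Q hQH hQp).1 hQℓ⟩
      rw [himg, (hinj.mono (Set.sdiff_subset_sdiff_left Set.inter_subset_right)).ncard_image,
        Set.ncard_sdiff_singleton_of_mem hpD, hcard, Nat.add_sub_cancel]
    · rintro a b ⟨v, hv, w, hw, hvw, hva, hwa⟩
      obtain ⟨P, ⟨hP, hPp⟩, rfl⟩ := (hmem v).1 hv
      obtain ⟨Q, ⟨hQ, hQp⟩, rfl⟩ := (hmem w).1 hw
      obtain ⟨ℓ, hℓ, hpℓ, hgraph⟩ := hc.exists_line a b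
      have hnt : ((hermSet R σ ε ∩ ℓ) ∩ U).Nontrivial :=
        ⟨P, ⟨⟨hUH hP, (hgraph P (hUH hP) hPp).2 hva⟩, hP⟩,
          Q, ⟨⟨hUH hQ, (hgraph Q (hUH hQ) hQp).2 hwa⟩, hQ⟩, fun e => hvw (by rw [e])⟩
      have hcard := hUblock _ ⟨ℓ, hℓ, hnt.mono Set.inter_subset_left, rfl⟩ hnt
      have hsub : (hermSet R σ ε ∩ ℓ) ∩ U ⊆ U \ {p} :=
        fun S hS => ⟨hS.2, fun e => hpℓ (e ▸ hS.1.2)⟩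
      have himg : {u : C × C | u ∈ hVfin.toFinset ∧ u.2 = a + b * u.1} =
          g '' ((hermSet R σ ε ∩ ℓ) ∩ U) := by
        ext u
        constructor
        · rintro ⟨hu, hu1⟩
          obtain ⟨S, ⟨hS, hSp⟩, rfl⟩ := (hmem u).1 hu
          exact ⟨S, ⟨⟨hUH hS, (hgraph S (hUH hS) hSp).2 hu1⟩, hS⟩, rfl⟩
        · rintro ⟨S, hS, rfl⟩
          exact ⟨(hmem _).2 ⟨S, hsub hS, rfl⟩, (hgraph S hS.1.1 (hsub hS).2).1 hS.1.2⟩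
      rw [himg, (hinj.mono hsub).ncard_image, hcard]
  intro w hw hwp v hv hvp hwv x hx hxp hxw
  have hxV : (z w, y w + (y x - y w)) ∈ hVfin.toFinset :=
    (hmem _).2 ⟨x, ⟨hx, hxp⟩, by simp [hg, hxw]⟩
  obtain ⟨u, ⟨hu, hup⟩, huv⟩ := (hmem _).1
    (key ((hmem _).2 ⟨w, ⟨hw, hwp⟩, rfl⟩) ((hmem _).2 ⟨v, ⟨hv, hvp⟩, rfl⟩) hwv hxV)
  exact ⟨u, hu, hup, congrArg Prod.fst huv, congrArg Prod.snd huv⟩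

end Conjugation

/-- Given a point `p` of a subunital `U` of order `q > 2`, a subunital block
`Bhat ∩ U` avoiding `p`, and the `q + 1` subunital blocks through `p` meeting it,
every point `x ≠ p` of `U` on one of these blocks (and off `Bhat ∩ U`) lies on a
subunital block meeting each of them in a point distinct from `p`. -/
theorem exists_subunital_transversal_block
    {C : Type*} [Field C] (R : Subfield C) (ε t d : C) (σ : C →+* C)
    (hrank : Module.finrank R C = 2)
    (hε : ε ∉ R) (ht : t ∈ R) (hd : d ∈ R)
    (hmin : ε ^ 2 - t * ε + d = 0)
    (hσR : ∀ r ∈ R, σ r = r) (hσε : σ ε = t - ε)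
    (q : ℕ) (hq : 2 < q)
    (U : Set (Projectivization C (Fin 3 → C))) (hU : IsSubunital R σ ε q U)
    (p : Projectivization C (Fin 3 → C)) (hp : p ∈ U)
    (Bhat : Set (Projectivization C (Fin 3 → C))) (hBhat : IsHermBlock R σ ε Bhat)
    (hBhatcard : (Bhat ∩ U).ncard = q + 1) (hpBhat : p ∉ Bhat)
    (Bs : Fin (q + 1) → Set (Projectivization C (Fin 3 → C)))
    (hBsinj : Function.Injective Bs)
    (hBs : ∀ i, IsSubBlock R σ ε U (Bs i))
    (hBsp : ∀ i, p ∈ Bs i)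
    (hBsmeet : ∀ i, (Bs i ∩ (Bhat ∩ U)).Nonempty)
    (hBsall : ∀ b, IsSubBlock R σ ε U b → p ∈ b → (b ∩ (Bhat ∩ U)).Nonempty → ∃ i, b = Bs i) :
    ∀ x ∈ U, x ≠ p → x ∉ Bhat ∩ U → (∃ i, x ∈ Bs i) →
      ∃ b', IsSubBlock R σ ε U b' ∧ x ∈ b' ∧
        ∀ i, ∃ y ∈ b' ∩ Bs i, y ≠ p := by
  obtain ⟨k, hk⟩ := exists_isUnitalConj hrank hε ht hd hmin hσR hσε
  obtain ⟨hUH, hUcard, hUblock⟩ := hU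
  obtain ⟨z, y, hc⟩ := hk.exists_isUnitalChart (hUH hp)
  have htrans := hk.translate_subunital (by omega) ⟨hUH, hUcard, hUblock⟩ hp hc
  have hz : ∀ i, ∀ P ∈ Bs i, ∀ Q ∈ Bs i, P ≠ p → Q ≠ p → z P = z Q := by
    intro i P hP Q hQ hPp hQp
    have hpi := hBsp i
    obtain ⟨_, ⟨ℓ, hℓ, -, rfl⟩, -, hi⟩ := hBs i
    rw [hi] at hP hQ hpi
    exact (hc.mem_iff ℓ hℓ hpi.1.2 Q hQ.1.1 hQp hQ.1.2 P hP.1.1 hPp).1 hP.1.2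
  have hz' : ∀ i, ∀ P ∈ Bs i, ∀ Q ∈ U, P ≠ p → Q ≠ p → z Q = z P → Q ∈ Bs i := by
    intro i P hP Q hQ hPp hQp hQz
    have hpi := hBsp i
    obtain ⟨_, ⟨ℓ, hℓ, -, rfl⟩, -, hi⟩ := hBs i
    rw [hi] at hP hpi ⊢
    exact ⟨⟨hUH hQ, (hc.mem_iff ℓ hℓ hpi.1.2 P hP.1.1 hPp hP.1.2 Q (hUH hQ) hQp).2 hQz⟩, hQ⟩
  rintro x hxU hxp - ⟨j, hxj⟩
  obtain ⟨ℓ, hℓ, -, rfl⟩ := hBhat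
  have hpℓ : p ∉ ℓ := fun h => hpBhat ⟨hUH hp, h⟩
  have hnep : ∀ P ∈ ℓ, P ≠ p := fun P hP e => hpℓ (e ▸ hP)
  obtain ⟨a, b, hab⟩ := hc.exists_graph ℓ hℓ hpℓ
  obtain ⟨w, hwj, ⟨hwH, hwℓ⟩, hwU⟩ := hBsmeet j
  have hwp := hnep w hwℓ
  have hxw : z x = z w := hz j x hxj w hwj hxp hwp
  have hyw := (hab w hwH hwp).1 hwℓ
  obtain ⟨ℓ', hℓ', hpℓ', hab'⟩ := hc.exists_line (a + (y x - y w)) b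
  have hxℓ' : x ∈ ℓ' := (hab' x (hUH hxU) hxp).2 (by rw [hxw]; linear_combination hyw)
  have hex : ∀ v ∈ (hermSet R σ ε ∩ ℓ) ∩ U, ∃ u ∈ (hermSet R σ ε ∩ ℓ') ∩ U, u ≠ p ∧ z u = z v := by
    rintro v ⟨⟨hvH, hvℓ⟩, hvU⟩
    have hvp := hnep v hvℓ
    have hyv := (hab v hvH hvp).1 hvℓ
    by_cases hvw : z w = z v
    · exact ⟨x, ⟨⟨hUH hxU, hxℓ'⟩, hxU⟩, hxp, hxw.trans hvw⟩
    obtain ⟨u, hu, hup, huz, huy⟩ := htrans w hwU hwp v hvU hvp hvw x hxU hxp hxw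
    exact ⟨u, ⟨⟨hUH hu, (hab' u (hUH hu) hup).2 (by rw [huz]; linear_combination huy + hyv)⟩, hu⟩,
      hup, huz⟩
  have hnt : ((hermSet R σ ε ∩ ℓ') ∩ U).Nontrivial := by
    have : 1 < ((hermSet R σ ε ∩ ℓ) ∩ U).ncard := by omega
    obtain ⟨v, hv, hvw⟩ := Set.exists_ne_of_one_lt_ncard this w
    obtain ⟨u, hu, hup, huz⟩ := hex v hv
    refine ⟨x, ⟨⟨hUH hxU, hxℓ'⟩, hxU⟩, u, hu, fun hxu => hvw ?_⟩
    have hvp := hnep v hv.1.2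
    have hzvw : z v = z w := by rw [← huz, ← hxu, hxw]
    exact hc.inj v hv.1.1 w hwH hvp hwp hzvw
      (by rw [(hab v hv.1.1 hvp).1 hv.1.2, hyw, hzvw])
  refine ⟨(hermSet R σ ε ∩ ℓ') ∩ U, ⟨_, ⟨ℓ', hℓ', hnt.mono Set.inter_subset_left, rfl⟩, hnt, rfl⟩,
    ⟨⟨hUH hxU, hxℓ'⟩, hxU⟩, fun i => ?_⟩
  obtain ⟨v, hvi, hv⟩ := hBsmeet i
  obtain ⟨u, hu, hup, huz⟩ := hex v hv
  exact ⟨u, ⟨hu, hz' i v hvi u hu.2 (hnep v hv.1.2) hup huz⟩, hup⟩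
end
end
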